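/- Let d ≥ 1 and 1 < p < ∞. (1) If s₁, s₂ ≤ d/p and s₁ + s₂ > d·max(0, 2/p − 1), then there exists C > 0, independent of τ, such that for all τ ≥ 0 and all Schwartz functions A, B on ℝ^d, setting f := e^{−τΛ₁}A and g := e^{−τΛ₁}B, one has ‖e^{τΛ₁}(fg)‖_{Ḃ^{s₁+s₂−d/p}_{p,1}} ≤ C·‖A‖_{Ḃ^{s₁}_{p,1}}·‖B‖_{Ḃ^{s₂}_{p,1}}. (2) If s₁ ≤ d/p, s₂ < d/p and s₁ + s₂ ≥ d·max(0, 2/p − 1), then likewise ‖e^{τΛ₁}(fg)‖_{Ḃ^{s₁+s₂−d/p}_{p,∞}} ≤ C·‖A‖_{Ḃ^{s₁}_{p,1}}·‖B‖_{Ḃ^{s₂}_{p,∞}}. -/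

import Mathlib

open MeasureTheory SchwartzMap Real
open scoped FourierTransform ENNReal NNReal

noncomputable section

abbrev Rd (d : ℕ) := EuclideanSpace ℝ (Fin d)

/-- Homogeneous Littlewood–Paley block Δ_j f = 𝓕⁻¹(φ(2^{-j}·)·𝓕 f). -/
def LPblock (d : ℕ) (φ : Rd d → ℝ) (j : ℤ) (f : Rd d → ℂ) : Rd d → ℂ :=
  𝓕⁻ fun ξ => (φ (((2:ℝ) ^ (-j)) • ξ) : ℂ) * 𝓕 f ξ

/-- ℓ^r norm (over ℤ) of a sequence of extended nonnegative reals. -/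
def seqNorm (r : ℝ≥0∞) (u : ℤ → ℝ≥0∞) : ℝ≥0∞ :=
  if r = ∞ then ⨆ j, u j else (∑' j, u j ^ r.toReal) ^ (1 / r.toReal)

/-- Homogeneous Besov norm ‖f‖_{Ḃ^s_{p,r}}. -/
def besovNorm (d : ℕ) (φ : Rd d → ℝ) (s : ℝ) (p r : ℝ≥0∞) (f : Rd d → ℂ) : ℝ≥0∞ :=
  seqNorm r fun j =>
    ENNReal.ofReal ((2:ℝ) ^ ((j : ℝ) * s)) * eLpNorm (LPblock d φ j f) p volume

/-- Low-frequency cut-off Ṡ_{j-1} f = ∑_{k ≤ j-2} Δ_k f. -/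
def lowFreq (d : ℕ) (φ : Rd d → ℝ) (j : ℤ) (f : Rd d → ℂ) : Rd d → ℂ :=
  fun x => ∑' k : ℤ, if k ≤ j - 2 then LPblock d φ k f x else 0

/-- Bony paraproduct T_a b = ∑_j Ṡ_{j-1}a · Δ_j b. -/
def para (d : ℕ) (φ : Rd d → ℝ) (a b : Rd d → ℂ) : Rd d → ℂ :=
  fun x => ∑' j : ℤ, lowFreq d φ j a x * LPblock d φ j b x

/-- Bony remainder R(a,b) = ∑_j (Δ_{j-1}a + Δ_j a + Δ_{j+1}a)·Δ_j b. -/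
def remainder (d : ℕ) (φ : Rd d → ℝ) (a b : Rd d → ℂ) : Rd d → ℂ :=
  fun x => ∑' j : ℤ,
    (LPblock d φ (j-1) a x + LPblock d φ j a x + LPblock d φ (j+1) a x) * LPblock d φ j b x

/-- Gevrey multiplier e^{τΛ₁} with symbol e^{τ|ξ|₁}, |ξ|₁ = ∑ᵢ|ξᵢ|. -/
def expL1 (d : ℕ) (τ : ℝ) (f : Rd d → ℂ) : Rd d → ℂ :=
  𝓕⁻ fun ξ => (Real.exp (τ * ∑ i, |ξ i|) : ℂ) * 𝓕 f ξ

/-- Jensen's inequality for the measure with density `k`. -/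
theorem lintegral_mul_rpow_le {α : Type*} [MeasurableSpace α] {μ : Measure α} {k w : α → ℝ≥0∞}
    (hk : AEMeasurable k μ) (hw : AEMeasurable w μ) {q : ℝ} (hq : 1 ≤ q) :
    (∫⁻ y, k y * w y ∂μ) ^ q ≤ (∫⁻ y, k y ∂μ) ^ (q - 1) * ∫⁻ y, k y * w y ^ q ∂μ := by
  rcases hq.eq_or_lt with rfl | hq
  · simp
  have hq0 : 0 < q := by linarith
  have hpq : (q.conjExponent).HolderConjugate q := (Real.HolderConjugate.conjExponent hq).symm
  have h1 := ENNReal.lintegral_mul_le_Lp_mul_Lq μ hpq (f := fun y => k y ^ (1 / q.conjExponent))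
    (g := fun y => k y ^ (1 / q) * w y) (hk.pow_const _) ((hk.pow_const _).mul hw)
  have e1 : ∀ y, ((fun y => k y ^ (1 / q.conjExponent)) * fun y => k y ^ (1 / q) * w y) y
      = k y * w y := by
    intro y
    simp only [Pi.mul_apply, ← mul_assoc]
    rw [← ENNReal.rpow_add_of_nonneg _ _ hpq.one_div_nonneg (by positivity)]
    rw [hpq.one_div_add_one_div]
    simp
  simp_rw [e1] at h1
  have e2 : ∀ y, (k y ^ (1 / q.conjExponent)) ^ q.conjExponent = k y := fun y => by
    rw [← ENNReal.rpow_mul, one_div_mul_cancel hpq.ne_zero, ENNReal.rpow_one]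
  have e3 : ∀ y, (k y ^ (1 / q) * w y) ^ q = k y * w y ^ q := fun y => by
    rw [ENNReal.mul_rpow_of_nonneg _ _ hq0.le, ← ENNReal.rpow_mul, one_div_mul_cancel hq0.ne',
      ENNReal.rpow_one]
  simp_rw [e2, e3] at h1
  refine (ENNReal.rpow_le_rpow h1 hq0.le).trans_eq ?_
  rw [ENNReal.mul_rpow_of_nonneg _ _ hq0.le, ← ENNReal.rpow_mul, ← ENNReal.rpow_mul,
    one_div_mul_cancel hq0.ne', ENNReal.rpow_one]
  congr 2
  have := hpq.one_div_add_one_div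
  have h2 : 1 / q.conjExponent = 1 - 1 / q := by linarith
  rw [h2]; field_simp

section Conv
variable {V : Type*} [NormedAddCommGroup V] [NormedSpace ℝ V] [FiniteDimensional ℝ V]
  [MeasurableSpace V] [BorelSpace V] (μ : Measure V) [μ.IsAddHaarMeasure]

/-- Bernstein-type form of Young's inequality for a kernel with `L¹` bound `a` and sup bound `b`. -/
theorem lintegral_conv_rpow_le {k w : V → ℝ≥0∞} (hk : Measurable k) (hw : Measurable w)
    {a b : ℝ≥0∞} (ha : ∫⁻ y, k y ∂μ ≤ a) (hb : ∀ y, k y ≤ b) {q P : ℝ} (hq : 1 ≤ q) (hqP : q ≤ P) :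
    (∫⁻ x, (∫⁻ y, k y * w (x - y) ∂μ) ^ P ∂μ) ≤
      a ^ ((q - 1) * (P / q) + 1) * b ^ (P / q - 1) * (∫⁻ x, w x ^ q ∂μ) ^ (P / q) := by
  have hq0 : 0 < q := by linarith
  have hPq : 1 ≤ P / q := by rw [le_div_iff₀ hq0]; linarith
  set Φ : V → ℝ≥0∞ := fun x => ∫⁻ y, k y * w (x - y) ^ q ∂μ with hΦ
  set W := ∫⁻ x, w x ^ q ∂μ with hW
  have hΦm : Measurable Φ := by
    apply Measurable.lintegral_prod_right' (f := fun z : V × V => k z.2 * w (z.1 - z.2) ^ q)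
    fun_prop
  have hΦb : ∀ x, Φ x ≤ b * W := fun x => by
    calc Φ x ≤ ∫⁻ y, b * w (x - y) ^ q ∂μ := lintegral_mono fun y => by gcongr; exact hb y
      _ = b * ∫⁻ y, w (x - y) ^ q ∂μ := by
          rw [lintegral_const_mul]; fun_prop
      _ = b * W := by rw [lintegral_sub_left_eq_self (fun y => w y ^ q) x]
  have hΦi : ∫⁻ x, Φ x ∂μ ≤ a * W := by
    rw [hΦ, lintegral_lintegral_swap (by fun_prop)]
    calc ∫⁻ y, ∫⁻ x, k y * w (x - y) ^ q ∂μ ∂μ = ∫⁻ y, k y * W ∂μ := by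
          congr with y
          rw [lintegral_const_mul _ (by fun_prop), lintegral_sub_right_eq_self (fun y => w y ^ q) y]
      _ = (∫⁻ y, k y ∂μ) * W := by rw [lintegral_mul_const _ hk]
      _ ≤ a * W := by gcongr
  have hpt : ∀ x, (∫⁻ y, k y * w (x - y) ∂μ) ^ P ≤
      a ^ ((q - 1) * (P / q)) * ((b * W) ^ (P / q - 1) * Φ x) := fun x => by
    have h1 := lintegral_mul_rpow_le (μ := μ) (k := k) (w := fun y => w (x - y)) hk.aemeasurable
      (by fun_prop) hq
    have h2 : (∫⁻ y, k y * w (x - y) ∂μ) ^ P = ((∫⁻ y, k y * w (x - y) ∂μ) ^ q) ^ (P / q) := by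
      rw [← ENNReal.rpow_mul]; congr 1; field_simp
    rw [h2]
    calc _ ≤ (a ^ (q - 1) * Φ x) ^ (P / q) := by
          gcongr; exact h1.trans (by gcongr)
      _ = a ^ ((q - 1) * (P / q)) * (Φ x) ^ (P / q - 1 + 1) := by
          rw [ENNReal.mul_rpow_of_nonneg _ _ (by linarith), ← ENNReal.rpow_mul]; congr 2; ring
      _ = a ^ ((q - 1) * (P / q)) * (Φ x ^ (P / q - 1) * Φ x) := by
          rw [ENNReal.rpow_add_of_nonneg _ _ (by linarith) zero_le_one, ENNReal.rpow_one]
      _ ≤ _ := by gcongr; exact hΦb x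
  calc _ ≤ ∫⁻ x, a ^ ((q - 1) * (P / q)) * ((b * W) ^ (P / q - 1) * Φ x) ∂μ := lintegral_mono hpt
    _ = a ^ ((q - 1) * (P / q)) * ((b * W) ^ (P / q - 1) * ∫⁻ x, Φ x ∂μ) := by
        rw [lintegral_const_mul _ (by fun_prop), lintegral_const_mul _ (by fun_prop)]
    _ ≤ a ^ ((q - 1) * (P / q)) * ((b * W) ^ (P / q - 1) * (a * W)) := by gcongr
    _ = (a ^ ((q - 1) * (P / q)) * a ^ (1:ℝ)) * b ^ (P / q - 1) *
          (W ^ (P / q - 1) * W ^ (1 : ℝ)) := by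
        rw [ENNReal.mul_rpow_of_nonneg _ _ (by linarith), ENNReal.rpow_one, ENNReal.rpow_one]; ring
    _ = _ := by
        rw [← ENNReal.rpow_add_of_nonneg _ _ _ zero_le_one,
          ← ENNReal.rpow_add_of_nonneg _ _ _ zero_le_one]
        · congr 2; ring
        · linarith
        · exact mul_nonneg (by linarith) (by linarith)

/-- The supremum endpoint of `lintegral_conv_rpow_le`. -/
theorem lintegral_conv_rpow_le_sup {k w : V → ℝ≥0∞} (hk : Measurable k) (hw : Measurable w)
    {a b : ℝ≥0∞} (ha : ∫⁻ y, k y ∂μ ≤ a) (hb : ∀ y, k y ≤ b) {q : ℝ} (hq : 1 ≤ q) (x : V) :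
    (∫⁻ y, k y * w (x - y) ∂μ) ^ q ≤ a ^ (q - 1) * b * ∫⁻ x, w x ^ q ∂μ := by
  have h1 := lintegral_mul_rpow_le (μ := μ) (k := k) (w := fun y => w (x - y)) hk.aemeasurable
      (by fun_prop) hq
  refine h1.trans ?_
  rw [mul_assoc]
  gcongr
  calc _ ≤ ∫⁻ y, b * w (x - y) ^ q ∂μ := lintegral_mono fun y => by gcongr; exact hb y
      _ = b * ∫⁻ y, w (x - y) ^ q ∂μ := by
          rw [lintegral_const_mul]; fun_prop
      _ = _ := by rw [lintegral_sub_left_eq_self (fun y => w y ^ q) x]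

end Conv

/-- The Cauchy kernel `i / (s + i y) = 1 / (y - i s)`. -/
def cauchyKernel (y s : ℝ) : ℂ := Complex.I / (s + y * Complex.I)

/-- The Cauchy transform of a density on the line. -/
def cauchyTransform (f : ℝ → ℝ) (z : ℂ) : ℂ := ∫ t, (f t : ℂ) * (Complex.I / (z - t))

theorem im_le_norm_sub_ofReal (z : ℂ) (t : ℝ) : z.im ≤ ‖z - t‖ := by
  have := Complex.abs_im_le_norm (z - t)
  simp at this
  exact (le_abs_self _).trans this

theorem sub_ofReal_ne_zero {z : ℂ} (hz : 0 < z.im) (t : ℝ) : z - t ≠ 0 := by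
  intro h
  have := im_le_norm_sub_ofReal z t
  rw [h] at this; simp at this; linarith

theorem norm_cauchy_term (a : ℝ) (z : ℂ) (t : ℝ) :
    ‖(a : ℂ) * (Complex.I / (z - t))‖ = |a| / ‖z - t‖ := by
  simp [div_eq_mul_inv]

theorem aestronglyMeasurable_cauchy_term {f : ℝ → ℝ} (hf : Integrable f) (z : ℂ) :
    AEStronglyMeasurable (fun t : ℝ => (f t : ℂ) * (Complex.I / (z - t))) volume := by
  have h1 : Measurable (fun t : ℝ => Complex.I / (z - t)) := by fun_prop
  exact (Complex.continuous_ofReal.comp_aestronglyMeasurable hf.1).mul h1.aestronglyMeasurable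

theorem integrable_cauchy_term {f : ℝ → ℝ} (hf : Integrable f) {z : ℂ} (hz : 0 < z.im) :
    Integrable (fun t : ℝ => (f t : ℂ) * (Complex.I / (z - t))) := by
  refine (hf.norm.mul_const (1 / z.im)).mono' (aestronglyMeasurable_cauchy_term hf z) ?_
  refine Filter.Eventually.of_forall fun t => ?_
  rw [norm_cauchy_term, div_eq_mul_one_div, Real.norm_eq_abs]
  gcongr
  exact im_le_norm_sub_ofReal z t

theorem norm_cauchyTransform_le {f : ℝ → ℝ} (hf : Integrable f) {z : ℂ} {c : ℝ}
    (h : ∀ t, f t ≠ 0 → 1 ≤ c * ‖z - t‖) :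
    ‖cauchyTransform f z‖ ≤ c * ∫ t, |f t| := by
  rw [cauchyTransform, ← integral_const_mul]
  refine norm_integral_le_of_norm_le (hf.norm.const_mul c) ?_
  refine Filter.Eventually.of_forall fun t => ?_
  rw [norm_cauchy_term]
  by_cases h0 : f t = 0
  · simp [h0]
  have h1 := h t h0
  have hpos : 0 < ‖z - t‖ := by
    rcases (norm_nonneg (z - t)).eq_or_lt with h2 | h2
    · rw [← h2] at h1; simp at h1; linarith
    · exact h2
  rw [div_le_iff₀ hpos]
  nlinarith [abs_nonneg (f t)]

theorem differentiableAt_cauchyTransform {f : ℝ → ℝ} (hf : Integrable f) {z : ℂ} (hz : 0 < z.im) :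
    DifferentiableAt ℂ (cauchyTransform f) z := by
  have key := hasDerivAt_integral_of_dominated_loc_of_deriv_le (μ := volume) (𝕜 := ℂ)
    (F := fun z t => (f t : ℂ) * (Complex.I / (z - t)))
    (F' := fun z t => (f t : ℂ) * (-Complex.I / (z - t) ^ 2))
    (x₀ := z) (s := Metric.ball z (z.im / 2)) (bound := fun t => |f t| * (1 / (z.im / 2) ^ 2))
    (Metric.ball_mem_nhds z (by positivity))
    (Filter.Eventually.of_forall fun w => aestronglyMeasurable_cauchy_term hf w)
    (integrable_cauchy_term hf hz) ?_ ?_ (hf.norm.mul_const _) ?_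
  · exact key.2.differentiableAt
  · have h1 : Measurable (fun t : ℝ => -Complex.I / (z - t) ^ 2) := by fun_prop
    exact (Complex.continuous_ofReal.comp_aestronglyMeasurable hf.1).mul h1.aestronglyMeasurable
  all_goals
    refine Filter.Eventually.of_forall fun t w hw => ?_
    have h1 : z.im / 2 ≤ w.im := by
      have h2 := Complex.abs_im_le_norm (w - z)
      rw [← dist_eq_norm] at h2
      have h3 := h2.trans_lt (Metric.mem_ball.1 hw)
      rw [abs_lt] at h3
      simp at h3; linarith
  · rw [norm_mul, norm_div, norm_neg, Complex.norm_I, norm_pow, Complex.norm_real, Real.norm_eq_abs]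
    gcongr
    exact h1.trans (im_le_norm_sub_ofReal w t)
  · have h0 : w - t ≠ 0 := sub_ofReal_ne_zero (by linarith) t
    have h2 := (((hasDerivAt_id w).sub_const (t : ℂ)).inv h0).const_mul Complex.I
    have h3 := h2.const_mul (f t : ℂ)
    simpa [div_eq_mul_inv] using h3

theorem re_cauchy_term (a : ℝ) (z : ℂ) (t : ℝ) :
    ((a : ℂ) * (Complex.I / (z - t))).re = a * (z.im / ((z.re - t) ^ 2 + z.im ^ 2)) := by
  rw [Complex.re_ofReal_mul, Complex.div_re]
  simp [Complex.normSq_apply]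
  left; ring_nf

theorem re_cauchyTransform {f : ℝ → ℝ} (hf : Integrable f) {z : ℂ} (hz : 0 < z.im) :
    (cauchyTransform f z).re = ∫ t, f t * (z.im / ((z.re - t) ^ 2 + z.im ^ 2)) := by
  rw [cauchyTransform, ← RCLike.re_eq_complex_re, ← integral_re (integrable_cauchy_term hf hz)]
  simp_rw [RCLike.re_eq_complex_re, re_cauchy_term]

theorem re_cauchyTransform_nonneg {f : ℝ → ℝ} (hf : Integrable f) (h0 : ∀ t, 0 ≤ f t) {z : ℂ}
    (hz : 0 < z.im) : 0 ≤ (cauchyTransform f z).re := by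
  rw [re_cauchyTransform hf hz]
  exact integral_nonneg fun t => mul_nonneg (h0 t) (by positivity)

theorem re_cauchyTransform_pos {f : ℝ → ℝ} (hf : Integrable f) (h0 : ∀ t, 0 ≤ f t)
    (hne : ¬ f =ᵐ[volume] 0) {z : ℂ} (hz : 0 < z.im) : 0 < (cauchyTransform f z).re := by
  refine (re_cauchyTransform_nonneg hf h0 hz).lt_of_ne fun h => hne ?_
  rw [re_cauchyTransform hf hz] at h
  have h1 : Integrable fun t => f t * (z.im / ((z.re - t) ^ 2 + z.im ^ 2)) := by
    have := (integrable_cauchy_term hf hz).re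
    simp_rw [RCLike.re_eq_complex_re, re_cauchy_term] at this
    exact this
  have h2 := (integral_eq_zero_iff_of_nonneg
    (fun t => mul_nonneg (h0 t) (by positivity)) h1).1 h.symm
  filter_upwards [h2] with t ht
  have : z.im / ((z.re - t) ^ 2 + z.im ^ 2) ≠ 0 := by positivity
  simpa [this] using ht

/-- The elementary inequality behind M. Riesz's theorem. -/
theorem exists_norm_rpow_le {p : ℝ} (hp : 1 < p) (hp2 : p ≤ 2) :
    ∃ A B : ℝ, 0 < A ∧ ∀ z : ℂ, 0 ≤ z.re →
      ‖z‖ ^ p ≤ A * z.re ^ p - B * (z ^ (p : ℂ)).re := by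
  have hp0 : 0 < p := by linarith
  set θ := π / 4 * (1 + 1 / p) with hθ
  have hpi := Real.pi_pos
  have hip : 1 / p < 1 := by rw [div_lt_one hp0]; exact hp
  have hip0 : 0 < 1 / p := by positivity
  have hpθ : p * θ = π / 4 * (p + 1) := by rw [hθ]; field_simp
  have hθ2 : θ < π / 2 := by rw [hθ]; nlinarith
  have hθ0 : 0 < θ := by positivity
  have hc : 0 < Real.cos θ := Real.cos_pos_of_mem_Ioo ⟨by linarith, hθ2⟩
  have hcp : Real.cos (p * θ) < 0 := by
    apply Real.cos_neg_of_pi_div_two_lt_of_lt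
    · rw [hpθ]; nlinarith
    · rw [hpθ]; nlinarith
  set B := -1 / Real.cos (p * θ) with hB
  have hBpos : 0 < B := div_pos_of_neg_of_neg (by norm_num) hcp
  refine ⟨(1 + B) / Real.cos θ ^ p, B, by positivity, fun z hz => ?_⟩
  have harg := Complex.abs_arg_le_pi_div_two_iff.2 hz
  rw [Complex.cpow_ofReal_re, ← Complex.norm_mul_cos_arg z,
    Real.mul_rpow (norm_nonneg z) (Real.cos_nonneg_of_mem_Icc (abs_le.1 harg))]
  suffices h : 1 ≤ (1 + B) / Real.cos θ ^ p * Real.cos z.arg ^ p - B * Real.cos (z.arg * p) by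
    have hn : 0 ≤ ‖z‖ ^ p := by positivity
    nlinarith [mul_le_mul_of_nonneg_left h hn]
  rw [← Real.cos_abs z.arg, ← Real.cos_abs (z.arg * p), abs_mul, abs_of_pos hp0]
  have ht := abs_nonneg z.arg
  generalize |z.arg| = t at harg ht
  rcases le_total θ t with h | h
  · have h1 : Real.cos (t * p) ≤ Real.cos (p * θ) := by
      rw [mul_comm t p]
      apply Real.cos_le_cos_of_nonneg_of_le_pi (by positivity)
      · nlinarith
      · gcongr
    have h2 : 1 ≤ -(B * Real.cos (t * p)) := by
      have : B * Real.cos (p * θ) = -1 := by rw [hB, div_mul_cancel₀ _ hcp.ne]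
      nlinarith
    have h3 : 0 ≤ (1 + B) / Real.cos θ ^ p * Real.cos t ^ p := by
      have : 0 ≤ Real.cos t := Real.cos_nonneg_of_mem_Icc ⟨by linarith, harg⟩
      positivity
    linarith
  · have h1 : (1 + B) ≤ (1 + B) / Real.cos θ ^ p * Real.cos t ^ p := by
      have : Real.cos θ ≤ Real.cos t := Real.cos_le_cos_of_nonneg_of_le_pi ht (by linarith) h
      rw [div_mul_eq_mul_div, le_div_iff₀ (by positivity)]
      gcongr
    have := mul_le_of_le_one_right hBpos.le (Real.cos_le_one (t * p))
    linarith

theorem one_add_abs_re_le {R y : ℝ} (hy : 0 < y) (hR : 0 ≤ R) {z : ℂ} (hz : y ≤ z.im) {t : ℝ}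
    (ht : |t| ≤ R) : 1 + |z.re| ≤ (1 + (1 + R) / y) * ‖z - t‖ := by
  have h1 := hz.trans (im_le_norm_sub_ofReal z t)
  have h2 := Complex.abs_re_le_norm (z - t)
  simp only [Complex.sub_re, Complex.ofReal_re] at h2
  have h3 : |z.re| ≤ |z.re - t| + |t| := by simpa using abs_add_le (z.re - t) t
  have h4 : (1 + R) ≤ (1 + R) / y * ‖z - t‖ := by
    rw [div_mul_eq_mul_div, le_div_iff₀ hy]; gcongr
  linarith

theorem norm_cauchyTransform_le_div {f : ℝ → ℝ} (hf : Integrable f) {R y : ℝ} (hR : 0 ≤ R)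
    (hsupp : ∀ t, f t ≠ 0 → |t| ≤ R) (hy : 0 < y) {z : ℂ} (hz : y ≤ z.im) :
    ‖cauchyTransform f z‖ ≤ (1 + (1 + R) / y) * (∫ t, |f t|) * (1 + |z.re|)⁻¹ := by
  have := norm_cauchyTransform_le hf (z := z) (c := (1 + (1 + R) / y) * (1 + |z.re|)⁻¹)
    fun t ht => ?_
  · linarith
  · have := one_add_abs_re_le hy hR hz (hsupp t ht)
    rw [mul_right_comm, ← div_eq_mul_inv, le_div_iff₀ (by positivity)]
    linarith

theorem continuous_cauchyTransform_line {f : ℝ → ℝ} (hf : Integrable f) {y : ℝ} (hy : 0 < y) :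
    Continuous fun x : ℝ => cauchyTransform f (x + y * Complex.I) := by
  refine continuous_iff_continuousAt.2 fun x => ?_
  have h1 : ContinuousAt (cauchyTransform f) (x + y * Complex.I) :=
    (differentiableAt_cauchyTransform hf (by simpa using hy)).continuousAt
  have h2 : ContinuousAt (fun x : ℝ => (x + y * Complex.I : ℂ)) x := by fun_prop
  exact ContinuousAt.comp (f := fun x : ℝ => (x + y * Complex.I : ℂ)) h1 h2

theorem integrable_norm_cauchyTransform_rpow {f : ℝ → ℝ} (hf : Integrable f) {R y : ℝ} (hR : 0 ≤ R)
    (hsupp : ∀ t, f t ≠ 0 → |t| ≤ R) (hy : 0 < y) {p : ℝ} (hp : 1 < p) :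
    Integrable fun x : ℝ => ‖cauchyTransform f (x + y * Complex.I)‖ ^ p := by
  have h1 : Integrable (fun x : ℝ => (1 + ‖x‖) ^ (-p)) := integrable_one_add_norm (by simpa using hp)
  refine (h1.const_mul (((1 + (1 + R) / y) * (∫ t, |f t|)) ^ p)).mono'
    ((continuous_cauchyTransform_line hf hy).norm.rpow_const fun _ => Or.inr
      (by linarith)).aestronglyMeasurable ?_
  refine Filter.Eventually.of_forall fun x => ?_
  have h2 := norm_cauchyTransform_le_div hf hR hsupp hy (z := x + y * Complex.I) (by simp)
  have hn : 0 ≤ ∫ t, |f t| := integral_nonneg fun t => abs_nonneg _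
  rw [Real.norm_of_nonneg (by positivity), Real.rpow_neg (by positivity),
    ← Real.inv_rpow (by positivity), ← Real.mul_rpow (by positivity) (by positivity)]
  gcongr
  simpa using h2

theorem integral_cauchyTransform_cpow {f : ℝ → ℝ} (hf : Integrable f) (h0 : ∀ t, 0 ≤ f t)
    (hne : ¬ f =ᵐ[volume] 0) {R y : ℝ} (hR : 0 ≤ R)
    (hsupp : ∀ t, f t ≠ 0 → |t| ≤ R) (hy : 0 < y) {p : ℝ} (hp : 1 < p) :
    Integrable (fun x : ℝ => cauchyTransform f (x + y * Complex.I) ^ (p : ℂ)) ∧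
    ∫ x : ℝ, cauchyTransform f (x + y * Complex.I) ^ (p : ℂ) = 0 := by
  have hd : ∀ z : ℂ, 0 < z.im → DifferentiableAt ℂ (fun z => cauchyTransform f z ^ (p : ℂ)) z :=
    fun z hz => (differentiableAt_cauchyTransform hf hz).cpow_const
      (Or.inl (re_cauchyTransform_pos hf h0 hne hz))
  have hi : Integrable (fun x : ℝ => cauchyTransform f (x + y * Complex.I) ^ (p : ℂ)) := by
    refine (integrable_norm_cauchyTransform_rpow hf hR hsupp hy hp).mono' ?_ ?_
    · refine Continuous.aestronglyMeasurable (continuous_iff_continuousAt.2 fun x => ?_)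
      have h2 : ContinuousAt (fun x : ℝ => (x + y * Complex.I : ℂ)) x := by fun_prop
      exact ContinuousAt.comp (f := fun x : ℝ => (x + y * Complex.I : ℂ))
        (hd (x + y * Complex.I) (by simpa using hy)).continuousAt h2
    · exact Filter.Eventually.of_forall fun x => (Complex.norm_cpow_real _ _).le
  refine ⟨hi, ?_⟩
  set M := (1 + (1 + R) / y) * (∫ t, |f t|) with hM
  have hn : 0 ≤ ∫ t, |f t| := integral_nonneg fun t => abs_nonneg _
  have hM0 : 0 ≤ M := by positivity
  have hNM : (∫ t, |f t|) ≤ M := by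
    rw [hM]; exact le_mul_of_one_le_left hn (by simp; positivity)
  have hlim := intervalIntegral_tendsto_integral hi Filter.tendsto_neg_atTop_atBot Filter.tendsto_id
  refine tendsto_nhds_unique hlim ?_
  rw [tendsto_zero_iff_norm_tendsto_zero]
  have hb : ∀ᶠ X : ℝ in Filter.atTop,
      ‖∫ x in (-X)..X, cauchyTransform f (x + y * Complex.I) ^ (p : ℂ)‖ ≤
        4 * M ^ p * X ^ (-(p - 1)) := by
    filter_upwards [Filter.eventually_gt_atTop 0] with X hX
    have hrect := Complex.integral_boundary_rect_eq_zero_of_differentiableOn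
      (fun z => cauchyTransform f z ^ (p : ℂ)) (⟨-X, y⟩ : ℂ) ⟨X, y + X⟩ (fun z hz => by
        refine (hd z ?_).differentiableWithinAt
        have h := (Complex.mem_reProdIm.1 hz).2
        simp only [Set.uIcc_of_le (show y ≤ y + X by linarith)] at h
        exact hy.trans_le h.1)
    simp only [smul_eq_mul] at hrect
    have hside : ∀ z : ℂ, y ≤ z.im → |z.re| = X → ‖cauchyTransform f z ^ (p : ℂ)‖ ≤ (M / X) ^ p := by
      intro z hz hX'
      rw [Complex.norm_cpow_real]
      gcongr
      refine (norm_cauchyTransform_le_div hf hR hsupp hy hz).trans ?_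
      rw [hX', ← hM, ← div_eq_mul_inv]
      gcongr
      linarith
    have htop : ∀ x : ℝ, ‖cauchyTransform f (x + ((y + X : ℝ) : ℂ) * Complex.I) ^ (p : ℂ)‖
        ≤ (M / X) ^ p := by
      intro x
      rw [Complex.norm_cpow_real]
      gcongr
      refine (norm_cauchyTransform_le hf (c := 1 / X) fun t _ => ?_).trans ?_
      · have := im_le_norm_sub_ofReal (x + ((y + X : ℝ) : ℂ) * Complex.I) t
        rw [one_div_mul_eq_div, le_div_iff₀ hX]
        simp at this ⊢
        linarith
      · rw [one_div_mul_eq_div]; gcongr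
    have e1 := intervalIntegral.norm_integral_le_of_norm_le_const (a := -X) (b := X)
      (C := (M / X) ^ p)
      (f := fun x : ℝ => cauchyTransform f (x + ((y + X : ℝ) : ℂ) * Complex.I) ^ (p : ℂ))
      (fun x _ => htop x)
    have e2 := intervalIntegral.norm_integral_le_of_norm_le_const (a := y) (b := y + X)
      (C := (M / X) ^ p)
      (f := fun v : ℝ => cauchyTransform f ((X : ℂ) + v * Complex.I) ^ (p : ℂ))
      (fun v hv => by
        rw [Set.uIoc_of_le (by linarith)] at hv
        exact hside _ (by simpa using hv.1.le) (by simpa using hX.le))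
    have e3 := intervalIntegral.norm_integral_le_of_norm_le_const (a := y) (b := y + X)
      (C := (M / X) ^ p)
      (f := fun v : ℝ => cauchyTransform f (((-X : ℝ) : ℂ) + v * Complex.I) ^ (p : ℂ))
      (fun v hv => by
        rw [Set.uIoc_of_le (by linarith)] at hv
        exact hside _ (by simpa using hv.1.le) (by simpa using hX.le))
    have habs1 : |X - -X| = 2 * X := by rw [abs_of_pos] <;> linarith
    have habs2 : |y + X - y| = X := by rw [abs_of_pos] <;> linarith
    rw [habs1] at e1
    rw [habs2] at e2 e3
    set J1 := ∫ x in (-X)..X, cauchyTransform f (x + y * Complex.I) ^ (p : ℂ)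
    set J2 := ∫ x in (-X)..X, cauchyTransform f (x + ((y + X : ℝ) : ℂ) * Complex.I) ^ (p : ℂ)
    set J3 := ∫ v in y..(y + X), cauchyTransform f ((X : ℂ) + v * Complex.I) ^ (p : ℂ)
    set J4 := ∫ v in y..(y + X), cauchyTransform f (((-X : ℝ) : ℂ) + v * Complex.I) ^ (p : ℂ)
    have hJ : J1 = J2 - Complex.I * J3 + Complex.I * J4 := by linear_combination hrect
    have hfin : (M / X) ^ p * X = M ^ p * X ^ (-(p - 1)) := by
      rw [Real.div_rpow hM0 hX.le, show -(p - 1) = 1 - p by ring, Real.rpow_sub hX, Real.rpow_one]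
      field_simp
    calc ‖J1‖ ≤ ‖J2‖ + ‖J3‖ + ‖J4‖ := by
          rw [hJ]
          refine (norm_add_le _ _).trans ?_
          have := norm_sub_le J2 (Complex.I * J3)
          simp at this ⊢
          linarith
      _ ≤ 4 * M ^ p * X ^ (-(p - 1)) := by linarith
  have hz : Filter.Tendsto (fun X : ℝ => 4 * M ^ p * X ^ (-(p - 1))) Filter.atTop (nhds 0) := by
    simpa using (tendsto_rpow_neg_atTop (show 0 < p - 1 by linarith)).const_mul (4 * M ^ p)
  exact squeeze_zero' (Filter.Eventually.of_forall fun _ => norm_nonneg _) hb hz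

theorem lintegral_poisson_le {y : ℝ} (hy : 0 < y) :
    ∫⁻ s : ℝ, ENNReal.ofReal (y / (s ^ 2 + y ^ 2)) ≤ ENNReal.ofReal π := by
  have h1 : ∀ s : ℝ, y / (s ^ 2 + y ^ 2) = y⁻¹ * (1 + (s / y) ^ 2)⁻¹ := fun s => by
    field_simp; ring
  have h2 : Integrable fun s : ℝ => y / (s ^ 2 + y ^ 2) := by
    simp_rw [h1]
    exact (integrable_inv_one_add_sq.comp_div hy.ne').const_mul _
  rw [← ofReal_integral_eq_lintegral_ofReal h2
    (Filter.Eventually.of_forall fun s => by positivity)]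
  refine ENNReal.ofReal_le_ofReal (le_of_eq ?_)
  simp_rw [h1]
  rw [integral_const_mul, Measure.integral_comp_div (fun s => (1 + s ^ 2)⁻¹),
    integral_univ_inv_one_add_sq, abs_of_pos hy, smul_eq_mul]
  field_simp

theorem lintegral_re_cauchyTransform_rpow_le {f : ℝ → ℝ} (hfm : Measurable f) (hf : Integrable f)
    (h0 : ∀ t, 0 ≤ f t) {y : ℝ} (hy : 0 < y) {p : ℝ} (hp : 1 < p) :
    ∫⁻ x : ℝ, ENNReal.ofReal (cauchyTransform f (x + y * Complex.I)).re ^ p ≤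
      ENNReal.ofReal π ^ p * ∫⁻ x, ENNReal.ofReal (f x) ^ p := by
  have hp0 : 0 < p := by linarith
  have hk : Measurable fun s : ℝ => ENNReal.ofReal (y / (s ^ 2 + y ^ 2)) := by fun_prop
  have key := lintegral_conv_rpow_le volume hk hfm.ennreal_ofReal
    (lintegral_poisson_le hy) (b := ENNReal.ofReal (y / y ^ 2)) (fun s => by
      apply ENNReal.ofReal_le_ofReal; gcongr; nlinarith [sq_nonneg s]) hp.le le_rfl
  have e : ∀ x : ℝ, ENNReal.ofReal (cauchyTransform f (x + y * Complex.I)).re =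
      ∫⁻ s : ℝ, ENNReal.ofReal (y / (s ^ 2 + y ^ 2)) * ENNReal.ofReal (f (x - s)) := fun x => by
    have hz : 0 < (x + y * Complex.I : ℂ).im := by simpa using hy
    rw [re_cauchyTransform hf hz, ofReal_integral_eq_lintegral_ofReal]
    · rw [← lintegral_sub_left_eq_self _ x]
      refine lintegral_congr fun s => ?_
      rw [mul_comm, ENNReal.ofReal_mul (by positivity)]
      simp
    · have := (integrable_cauchy_term hf hz).re
      simp_rw [RCLike.re_eq_complex_re, re_cauchy_term] at this
      exact this
    · exact Filter.Eventually.of_forall fun t => mul_nonneg (h0 t) (by positivity)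
  simp_rw [e]
  refine key.trans_eq ?_
  rw [div_self hp0.ne']
  simp

theorem exists_lintegral_cauchyTransform_rpow_le {p : ℝ} (hp : 1 < p) (hp2 : p ≤ 2) :
    ∃ C : ℝ≥0, ∀ y : ℝ, 0 < y → ∀ f : ℝ → ℝ, Measurable f → Integrable f → (∀ t, 0 ≤ f t) →
      (∃ R, ∀ t, f t ≠ 0 → |t| ≤ R) →
      ∫⁻ x : ℝ, ‖cauchyTransform f (x + y * Complex.I)‖ₑ ^ p ≤ C * ∫⁻ x, ‖f x‖ₑ ^ p := by
  obtain ⟨A, B, hA, hAB⟩ := exists_norm_rpow_le hp hp2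
  have hp0 : 0 < p := by linarith
  refine ⟨A.toNNReal * (Real.toNNReal π) ^ p, fun y hy f hfm hf h0 ⟨R', hR'⟩ => ?_⟩
  by_cases hne : f =ᵐ[volume] 0
  · have : ∀ z, cauchyTransform f z = 0 := fun z => by
      rw [cauchyTransform]
      refine integral_eq_zero_of_ae ?_
      filter_upwards [hne] with t ht
      simp [ht]
    simp [this, hp0]
  set R := max R' 0
  have hsupp : ∀ t, f t ≠ 0 → |t| ≤ R := fun t ht => (hR' t ht).trans (le_max_left _ _)
  have hR : 0 ≤ R := le_max_right _ _
  obtain ⟨hi, hI⟩ := integral_cauchyTransform_cpow hf h0 hne hR hsupp hy hp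
  have hin := integrable_norm_cauchyTransform_rpow hf hR hsupp hy hp
  have hre0 : ∀ x : ℝ, 0 ≤ (cauchyTransform f (x + y * Complex.I)).re := fun x =>
    re_cauchyTransform_nonneg hf h0 (by simpa using hy)
  have hire : Integrable fun x : ℝ => (cauchyTransform f (x + y * Complex.I)).re ^ p := by
    refine hin.mono' (((Complex.continuous_re.comp
      (continuous_cauchyTransform_line hf hy)).rpow_const
        fun _ => Or.inr hp0.le).aestronglyMeasurable) (Filter.Eventually.of_forall fun x => ?_)
    have := hre0 x
    rw [Real.norm_of_nonneg (by positivity)]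
    gcongr
    exact Complex.re_le_norm _
  have hmain : ∫ x : ℝ, ‖cauchyTransform f (x + y * Complex.I)‖ ^ p ≤
      A * ∫ x : ℝ, (cauchyTransform f (x + y * Complex.I)).re ^ p := by
    have h1 := integral_mono hin ((hire.const_mul A).sub (hi.re.const_mul B))
      fun x => hAB _ (hre0 x)
    refine h1.trans_eq ?_
    simp only [Pi.sub_apply]
    rw [integral_sub (hire.const_mul A) (hi.re.const_mul B), integral_const_mul, integral_const_mul,
      integral_re hi, hI]
    simp
  have e1 : ∫⁻ x : ℝ, ‖cauchyTransform f (x + y * Complex.I)‖ₑ ^ p =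
      ENNReal.ofReal (∫ x : ℝ, ‖cauchyTransform f (x + y * Complex.I)‖ ^ p) := by
    rw [ofReal_integral_eq_lintegral_ofReal hin (Filter.Eventually.of_forall fun x => by positivity)]
    refine lintegral_congr fun x => ?_
    rw [← ENNReal.ofReal_rpow_of_nonneg (norm_nonneg _) hp0.le, ofReal_norm]
  have e2 : ENNReal.ofReal (∫ x : ℝ, (cauchyTransform f (x + y * Complex.I)).re ^ p) =
      ∫⁻ x : ℝ, ENNReal.ofReal (cauchyTransform f (x + y * Complex.I)).re ^ p := by
    rw [ofReal_integral_eq_lintegral_ofReal hire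
      (Filter.Eventually.of_forall fun x => Real.rpow_nonneg (hre0 x) _)]
    refine lintegral_congr fun x => ?_
    rw [← ENNReal.ofReal_rpow_of_nonneg (hre0 x) hp0.le]
  rw [e1]
  refine (ENNReal.ofReal_le_ofReal hmain).trans ?_
  rw [ENNReal.ofReal_mul hA.le, e2]
  refine (mul_le_mul_right (lintegral_re_cauchyTransform_rpow_le hfm hf h0 hy hp) _).trans_eq ?_
  rw [← mul_assoc]
  congr 1
  · rw [ENNReal.coe_mul, ENNReal.coe_rpow_of_nonneg _ hp0.le]; rfl
  · refine lintegral_congr fun x => ?_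
    rw [← ofReal_norm, Real.norm_of_nonneg (h0 x)]

/-- Convolution with the Cauchy kernel. -/
def cauchyConv (y : ℝ) (f : ℝ → ℂ) (x : ℝ) : ℂ := ∫ t, f t * cauchyKernel y (x - t)

theorem cauchyConv_ofReal (y : ℝ) (f : ℝ → ℝ) (x : ℝ) :
    cauchyConv y (fun t => (f t : ℂ)) x = cauchyTransform f (x + y * Complex.I) := by
  rw [cauchyConv, cauchyTransform]
  congr with t
  rw [cauchyKernel]; congr 2; push_cast; ring

theorem continuous_cauchyKernel {y : ℝ} (hy : 0 < y) : Continuous (cauchyKernel y) := by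
  unfold cauchyKernel
  refine Continuous.div continuous_const (by fun_prop) fun s h => ?_
  have := congrArg Complex.im h
  simp at this; linarith

theorem norm_cauchyKernel_le {y : ℝ} (hy : 0 < y) (s : ℝ) : ‖cauchyKernel y s‖ ≤ 1 / y := by
  rw [cauchyKernel, norm_div, Complex.norm_I]
  gcongr
  have := Complex.abs_im_le_norm (s + y * Complex.I)
  simp at this
  exact (le_abs_self _).trans this

theorem integrable_mul_cauchyKernel {y : ℝ} (hy : 0 < y) {f : ℝ → ℂ} (hf : Integrable f) (x : ℝ) :
    Integrable fun t => f t * cauchyKernel y (x - t) := by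
  have hc := continuous_cauchyKernel hy
  refine hf.mul_bdd (c := 1 / y)
    (hc.comp (continuous_const.sub continuous_id)).aestronglyMeasurable ?_
  exact Filter.Eventually.of_forall fun t => norm_cauchyKernel_le hy _

/-- M. Riesz's theorem for the Cauchy kernel, `1 < p ≤ 2`. -/
theorem exists_eLpNorm_cauchyConv_le_of_le_two {p : ℝ} (hp : 1 < p) (hp2 : p ≤ 2) :
    ∃ C : ℝ≥0, ∀ y : ℝ, 0 < y → ∀ f : ℝ → ℂ, Measurable f → Integrable f →
      (∃ R, ∀ t, f t ≠ 0 → |t| ≤ R) →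
      eLpNorm (cauchyConv y f) (ENNReal.ofReal p) volume ≤
        C * eLpNorm f (ENNReal.ofReal p) volume := by
  obtain ⟨C, hC⟩ := exists_lintegral_cauchyTransform_rpow_le hp hp2
  have hp0 : 0 < p := by linarith
  have hpE : ENNReal.ofReal p ≠ 0 := by simpa using hp0
  have hp1 : 1 ≤ ENNReal.ofReal p := by simpa using hp.le
  have hreal : ∀ y : ℝ, 0 < y → ∀ f : ℝ → ℝ, Measurable f → Integrable f → (∀ t, 0 ≤ f t) →
      (∃ R, ∀ t, f t ≠ 0 → |t| ≤ R) →
      eLpNorm (cauchyConv y (fun t => (f t : ℂ))) (ENNReal.ofReal p) volume ≤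
        (C ^ (1 / p) : ℝ≥0) * eLpNorm f (ENNReal.ofReal p) volume := by
    intro y hy f hfm hf h0 hR
    rw [eLpNorm_eq_lintegral_rpow_enorm_toReal hpE ENNReal.ofReal_ne_top,
      eLpNorm_eq_lintegral_rpow_enorm_toReal hpE ENNReal.ofReal_ne_top, ENNReal.toReal_ofReal hp0.le,
      ENNReal.coe_rpow_of_nonneg _ (by positivity), ← ENNReal.mul_rpow_of_nonneg _ _ (by positivity)]
    gcongr
    simp_rw [cauchyConv_ofReal]
    exact hC y hy f hfm hf h0 hR
  refine ⟨4 * C ^ (1 / p), fun y hy f hfm hf ⟨R, hR⟩ => ?_⟩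
  have hpart : ∀ g : ℝ → ℝ, Measurable g → (∀ t, 0 ≤ g t) → (∀ t, g t ≤ ‖f t‖) →
      Integrable g ∧ eLpNorm (cauchyConv y (fun t => (g t : ℂ))) (ENNReal.ofReal p) volume ≤
        (C ^ (1 / p) : ℝ≥0) * eLpNorm f (ENNReal.ofReal p) volume := by
    intro g hg h0 hle
    have hgi : Integrable g := hf.norm.mono' hg.aestronglyMeasurable
      (Filter.Eventually.of_forall fun t => by rw [Real.norm_of_nonneg (h0 t)]; exact hle t)
    refine ⟨hgi, (hreal y hy g hg hgi h0 ⟨R, fun t ht => hR t fun h => ht ?_⟩).trans ?_⟩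
    · have := hle t; rw [h, norm_zero] at this; exact le_antisymm this (h0 t)
    · gcongr
      exact eLpNorm_mono fun t => by rw [Real.norm_of_nonneg (h0 t)]; exact hle t
  obtain ⟨i1, b1⟩ := hpart (fun t => max (f t).re 0) (by fun_prop) (fun t => le_max_right _ _)
    fun t => max_le (Complex.re_le_norm _) (norm_nonneg _)
  obtain ⟨i2, b2⟩ := hpart (fun t => max (-(f t).re) 0) (by fun_prop) (fun t => le_max_right _ _)
    fun t => max_le ((neg_le_abs _).trans (Complex.abs_re_le_norm _)) (norm_nonneg _)
  obtain ⟨i3, b3⟩ := hpart (fun t => max (f t).im 0) (by fun_prop) (fun t => le_max_right _ _)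
    fun t => max_le (Complex.im_le_norm _) (norm_nonneg _)
  obtain ⟨i4, b4⟩ := hpart (fun t => max (-(f t).im) 0) (by fun_prop) (fun t => le_max_right _ _)
    fun t => max_le ((neg_le_abs _).trans (Complex.abs_im_le_norm _)) (norm_nonneg _)
  have hmeas : ∀ g : ℝ → ℝ, Integrable g →
      AEStronglyMeasurable (cauchyConv y (fun t => (g t : ℂ))) volume := fun g hg => by
    have : cauchyConv y (fun t => (g t : ℂ)) = fun x : ℝ => cauchyTransform g (x + y * Complex.I) :=
      funext fun x => cauchyConv_ofReal y g x
    rw [this]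
    exact (continuous_cauchyTransform_line hg hy).aestronglyMeasurable
  have hdecomp : cauchyConv y f = (cauchyConv y (fun t => ((max (f t).re 0 : ℝ) : ℂ))
      - cauchyConv y (fun t => ((max (-(f t).re) 0 : ℝ) : ℂ)))
      + Complex.I • (cauchyConv y (fun t => ((max (f t).im 0 : ℝ) : ℂ))
      - cauchyConv y (fun t => ((max (-(f t).im) 0 : ℝ) : ℂ))) := by
    funext x
    have hc : ∀ g : ℝ → ℝ, Integrable g → Integrable fun t => (g t : ℂ) * cauchyKernel y (x - t) :=
      fun g hg => integrable_mul_cauchyKernel hy hg.ofReal x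
    simp only [cauchyConv, Pi.add_apply, Pi.sub_apply, Pi.smul_apply, smul_eq_mul]
    rw [← integral_sub (hc _ i1)
        (hc _ i2),
      ← integral_sub (hc _ i3)
        (hc _ i4), ← integral_const_mul, ← integral_add]
    · refine integral_congr_ae (Filter.Eventually.of_forall fun t => ?_)
      have hs : ∀ a : ℝ, ((max a 0 : ℝ) : ℂ) - ((max (-a) 0 : ℝ) : ℂ) = a := fun a => by
        rw [← Complex.ofReal_sub]
        congr 1
        rcases le_total 0 a with h | h
        · rw [max_eq_left h, max_eq_right (by linarith)]; ring
        · rw [max_eq_right h, max_eq_left (by linarith)]; ring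
      have h1 := hs (f t).re
      have h2 := hs (f t).im
      have h3 := Complex.re_add_im (f t)
      simp only
      rw [← sub_mul, ← sub_mul, h1, h2]
      conv_lhs => rw [← h3]
      ring
    · exact (hc _ i1).sub
        (hc _ i2)
    · exact ((hc _ i3).sub
        (hc _ i4)).const_mul _
  have m1 := hmeas _ i1
  have m2 := hmeas _ i2
  have m3 := hmeas _ i3
  have m4 := hmeas _ i4
  rw [hdecomp]
  refine (eLpNorm_add_le (m1.sub m2) ((m3.sub m4).const_smul _) hp1).trans ?_
  rw [eLpNorm_const_smul]
  simp only [enorm_eq_nnnorm, Complex.nnnorm_I, ENNReal.coe_one, one_mul]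
  refine (add_le_add ((eLpNorm_sub_le m1 m2 hp1).trans (add_le_add b1 b2))
    ((eLpNorm_sub_le m3 m4 hp1).trans (add_le_add b3 b4))).trans_eq ?_
  push_cast
  ring

/-- Convolution on the line, with the kernel first. -/
def lineConv (K f : ℝ → ℂ) (x : ℝ) : ℂ := ∫ t, K t * f (x - t)

theorem lineConv_eq (K f : ℝ → ℂ) (x : ℝ) : lineConv K f x = ∫ t, f t * K (x - t) := by
  rw [lineConv, ← integral_sub_left_eq_self _ _ x]
  congr with t
  rw [sub_sub_cancel, mul_comm]

theorem measurable_lineConv {K f : ℝ → ℂ} (hK : Measurable K) (hf : Measurable f) :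
    Measurable (lineConv K f) := by
  have : StronglyMeasurable (Function.uncurry fun x t : ℝ => K t * f (x - t)) := by
    apply Measurable.stronglyMeasurable
    exact (hK.comp measurable_snd).mul (hf.comp (measurable_fst.sub measurable_snd))
  exact this.integral_prod_right.measurable

theorem integrable_lineConv_integrand {K f : ℝ → ℂ} (hK : Integrable K) (hf : Measurable f) {B : ℝ}
    (hB : ∀ t, ‖f t‖ ≤ B) (x : ℝ) : Integrable fun t => K t * f (x - t) :=
  hK.mul_bdd (c := B) (hf.comp (measurable_const.sub measurable_id)).aestronglyMeasurable
    (Filter.Eventually.of_forall fun _ => hB _)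

theorem norm_lineConv_le {K f : ℝ → ℂ} (hK : Integrable K) {B : ℝ}
    (hB : ∀ t, ‖f t‖ ≤ B) (x : ℝ) : ‖lineConv K f x‖ ≤ (∫ t, ‖K t‖) * B := by
  rw [lineConv, ← integral_mul_const]
  refine norm_integral_le_of_norm_le (hK.norm.mul_const B) (Filter.Eventually.of_forall fun t => ?_)
  rw [norm_mul]
  gcongr
  exact hB _

theorem eLpNorm_lineConv_le_of_compact {K : ℝ → ℂ} (hKm : Measurable K) (hK : Integrable K)
    {p : ℝ≥0∞} {C : ℝ≥0∞}
    (h : ∀ f : ℝ → ℂ, Measurable f → Integrable f → (∃ B, ∀ t, ‖f t‖ ≤ B) →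
      (∃ R, ∀ t, f t ≠ 0 → |t| ≤ R) → eLpNorm (lineConv K f) p volume ≤ C * eLpNorm f p volume)
    {f : ℝ → ℂ} (hf : Measurable f) {B : ℝ} (hB : ∀ t, ‖f t‖ ≤ B) :
    eLpNorm (lineConv K f) p volume ≤ C * eLpNorm f p volume := by
  set F : ℕ → ℝ → ℂ := fun n => (Set.Icc (-(n : ℝ)) n).indicator f with hF
  have hFm : ∀ n, Measurable (F n) := fun n => hf.indicator measurableSet_Icc
  have hFB : ∀ n t, ‖F n t‖ ≤ B := fun n t =>
    (norm_indicator_le_norm_self f t).trans (hB t)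
  have hlim : ∀ x, Filter.Tendsto (fun n => lineConv K (F n) x) Filter.atTop
      (nhds (lineConv K f x)) := fun x => by
    refine tendsto_integral_of_dominated_convergence (fun t => ‖K t‖ * B)
      (fun n => (integrable_lineConv_integrand hK (hFm n) (hFB n) x).1) (hK.norm.mul_const B)
      (fun n => Filter.Eventually.of_forall fun t => ?_) (Filter.Eventually.of_forall fun t => ?_)
    · rw [norm_mul]; gcongr; exact hFB n _
    · refine tendsto_const_nhds.congr' ?_
      obtain ⟨N, hN⟩ := exists_nat_ge |x - t|
      filter_upwards [Filter.eventually_ge_atTop N] with n hn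
      have : x - t ∈ Set.Icc (-(n : ℝ)) n := by
        rw [Set.mem_Icc, ← abs_le]; exact hN.trans (by exact_mod_cast hn)
      simp only [hF]
      rw [Set.indicator_of_mem this]
  refine (Lp.eLpNorm_lim_le_liminf_eLpNorm
    (fun n => (measurable_lineConv hKm (hFm n)).aestronglyMeasurable) _
    (Filter.Eventually.of_forall hlim)).trans ?_
  refine Filter.liminf_le_of_frequently_le' (Filter.Frequently.of_forall fun n => ?_)
  refine (h (F n) (hFm n) ?_ ⟨B, hFB n⟩ ⟨n, fun t ht => ?_⟩).trans ?_
  · have : Integrable ((Set.Icc (-(n : ℝ)) n).indicator fun _ : ℝ => B) :=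
      (integrable_indicator_iff measurableSet_Icc).2 (by simp)
    refine this.mono' (hFm n).aestronglyMeasurable (Filter.Eventually.of_forall fun t => ?_)
    simp only [hF]
    rw [norm_indicator_eq_indicator_norm]
    exact Set.indicator_le_indicator (hB t)
  · have h' : t ∈ Set.Icc (-(n : ℝ)) n := Set.mem_of_indicator_ne_zero ht
    exact abs_le.2 h'
  · gcongr
    exact eLpNorm_mono fun t => norm_indicator_le_norm_self f t

theorem eLpNorm_ofReal_eq {α : Type*} [MeasurableSpace α] {μ : Measure α} {p : ℝ} (hp : 0 < p)
    (f : α → ℂ) : eLpNorm f (ENNReal.ofReal p) μ = (∫⁻ x, ‖f x‖ₑ ^ p ∂μ) ^ (1 / p) := by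
  rw [eLpNorm_eq_lintegral_rpow_enorm_toReal (by simpa using hp) ENNReal.ofReal_ne_top,
    ENNReal.toReal_ofReal hp.le]

/-- Duality for Hermitian convolution kernels. -/
theorem eLpNorm_lineConv_le_dual {K : ℝ → ℂ} (hKm : Measurable K) (hK : Integrable K)
    (hherm : ∀ s, K (-s) = (starRingEnd ℂ) (K s)) {p q : ℝ} (hpq : p.HolderConjugate q) {C : ℝ≥0∞}
    (h : ∀ g : ℝ → ℂ, Measurable g → (∃ B, ∀ t, ‖g t‖ ≤ B) →
      eLpNorm (lineConv K g) (ENNReal.ofReal q) volume ≤ C * eLpNorm g (ENNReal.ofReal q) volume)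
    (hp2 : 2 ≤ p) {f : ℝ → ℂ} (hf : Measurable f) (hfi : Integrable f) {B : ℝ}
    (hB : ∀ t, ‖f t‖ ≤ B) :
    eLpNorm (lineConv K f) (ENNReal.ofReal p) volume ≤ C * eLpNorm f (ENNReal.ofReal p) volume := by
  have hp0 : 0 < p := hpq.pos
  have hq0 : 0 < q := hpq.symm.pos
  have hftop : ∫⁻ x, ‖f x‖ₑ ^ p ≠ ⊤ := by
    have h1 : ∀ x, ‖f x‖ₑ ^ p ≤ ENNReal.ofReal B ^ (p - 1) * ‖f x‖ₑ := fun x => by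
      rw [show p = p - 1 + 1 by ring, ENNReal.rpow_add_of_nonneg _ _ (by linarith) zero_le_one,
        ENNReal.rpow_one, add_sub_cancel_right]
      gcongr
      · linarith
      · rw [← ofReal_norm]
        exact ENNReal.ofReal_le_ofReal (hB x)
    refine ne_top_of_le_ne_top ?_ (lintegral_mono h1)
    rw [lintegral_const_mul _ hf.enorm]
    exact ENNReal.mul_ne_top (ENNReal.rpow_ne_top_of_nonneg (by linarith) ENNReal.ofReal_ne_top)
      hfi.2.ne
  set u := lineConv K f with hu
  have hum : Measurable u := measurable_lineConv hKm hf
  set M := (∫ t, ‖K t‖) * B with hM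
  have huM : ∀ x, ‖u x‖ ≤ M := norm_lineConv_le hK hB
  set g : ℝ → ℂ := fun x => (starRingEnd ℂ) (u x) * ((‖u x‖ ^ (p - 2) : ℝ) : ℂ) with hg
  have hgm : Measurable g := by
    refine (Complex.continuous_conj.measurable.comp hum).mul ?_
    exact Complex.measurable_ofReal.comp (hum.norm.pow_const _)
  have hgn : ∀ x, ‖g x‖ = ‖u x‖ ^ (p - 1) := fun x => by
    simp only [hg]
    rw [norm_mul, RCLike.norm_conj, Complex.norm_real, Real.norm_of_nonneg (by positivity)]
    rcases (norm_nonneg (u x)).eq_or_lt with h0 | h0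
    · rw [← h0, zero_mul, Real.zero_rpow (by linarith)]
    · rw [show p - 1 = 1 + (p - 2) by ring, Real.rpow_add h0, Real.rpow_one]
  have hgB : ∀ x, ‖g x‖ ≤ M ^ (p - 1) := fun x => by
    rw [hgn]; exact Real.rpow_le_rpow (norm_nonneg _) (huM x) (by linarith)
  have hug : ∀ x, u x * g x = ((‖u x‖ ^ p : ℝ) : ℂ) := fun x => by
    simp only [hg]
    rw [← mul_assoc, Complex.mul_conj, Complex.normSq_eq_norm_sq, ← Complex.ofReal_mul]
    congr 1
    rcases (norm_nonneg (u x)).eq_or_lt with h0 | h0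
    · rw [← h0]; simp [Real.zero_rpow hp0.ne']
    · rw [← Real.rpow_natCast, ← Real.rpow_add h0]; congr 1; push_cast; ring
  set I := ∫⁻ x, ‖u x‖ₑ ^ p with hI
  have hItop : I ≠ ⊤ := by
    have key := lintegral_conv_rpow_le volume (hKm.enorm) (hf.enorm) (a := ∫⁻ t, ‖K t‖ₑ)
      (b := ⊤) le_rfl (fun _ => le_top) hpq.lt.le le_rfl
    rw [div_self hp0.ne'] at key
    simp only [sub_self, ENNReal.rpow_zero, mul_one, ENNReal.rpow_one, sub_add_cancel] at key
    refine ne_top_of_le_ne_top (ENNReal.mul_ne_top (ENNReal.rpow_ne_top_of_nonneg hp0.le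
      hK.2.ne) hftop) (le_trans (lintegral_mono fun x => ?_) key)
    gcongr
    refine (enorm_integral_le_lintegral_enorm _).trans_eq ?_
    simp_rw [enorm_mul]
  have hswap : ∫ x, u x * g x = ∫ t, f t * (starRingEnd ℂ) (lineConv K (fun x => (starRingEnd ℂ) (g x)) t) := by
    have hInteg : Integrable (Function.uncurry fun x t : ℝ => f t * K (x - t) * g x)
        (volume.prod volume) := by
      have h1 := hfi.convolution_integrand (ContinuousLinearMap.mul ℝ ℂ) hK
      exact h1.mul_bdd (c := M ^ (p - 1)) (hgm.comp measurable_fst).aestronglyMeasurable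
        (Filter.Eventually.of_forall fun z => hgB _)
    calc ∫ x, u x * g x = ∫ x, ∫ t, f t * K (x - t) * g x := by
          congr with x
          rw [hu, lineConv_eq, integral_mul_const]
      _ = ∫ t, ∫ x, f t * K (x - t) * g x := integral_integral_swap hInteg
      _ = _ := by
          congr with t
          rw [lineConv, ← integral_conj, ← integral_const_mul, ← integral_sub_left_eq_self _ _ t]
          congr with x
          rw [map_mul, Complex.conj_conj, ← hherm]
          ring_nf
  have hmain : I ≤ ∫⁻ t, ‖f t‖ₑ * ‖lineConv K (fun x => (starRingEnd ℂ) (g x)) t‖ₑ := by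
    have hin : Integrable fun x => ‖u x‖ ^ p := by
      refine ⟨(hum.norm.pow_const p).aestronglyMeasurable, ?_⟩
      rw [HasFiniteIntegral]
      have : ∀ x, ‖‖u x‖ ^ p‖ₑ = ‖u x‖ₑ ^ p := fun x => by
        rw [← ofReal_norm, Real.norm_of_nonneg (by positivity),
          ← ENNReal.ofReal_rpow_of_nonneg (norm_nonneg _) hp0.le, ofReal_norm]
      simp_rw [this]
      exact hItop.lt_top
    have h1 : I = ‖∫ x, u x * g x‖ₑ := by
      simp_rw [hug]
      rw [integral_complex_ofReal, ← ofReal_norm, Complex.norm_real,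
        Real.norm_of_nonneg (integral_nonneg fun x => by positivity),
        ofReal_integral_eq_lintegral_ofReal hin (Filter.Eventually.of_forall fun x => by positivity)]
      refine lintegral_congr fun x => ?_
      rw [← ENNReal.ofReal_rpow_of_nonneg (norm_nonneg _) hp0.le, ofReal_norm]
    rw [h1, hswap]
    refine (enorm_integral_le_lintegral_enorm _).trans_eq ?_
    refine lintegral_congr fun t => ?_
    rw [enorm_mul, RCLike.enorm_conj]
  have hgcm : Measurable fun x => (starRingEnd ℂ) (g x) :=
    Complex.continuous_conj.measurable.comp hgm
  have hHol := ENNReal.lintegral_mul_le_Lp_mul_Lq volume hpq hf.enorm.aemeasurable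
    (measurable_lineConv hKm hgcm).enorm.aemeasurable
  have hb := h _ hgcm ⟨M ^ (p - 1), fun x => by rw [RCLike.norm_conj]; exact hgB x⟩
  rw [eLpNorm_ofReal_eq hq0, eLpNorm_ofReal_eq hq0] at hb
  have hgI : ∫⁻ x, ‖(starRingEnd ℂ) (g x)‖ₑ ^ q = I := by
    refine lintegral_congr fun x => ?_
    rw [RCLike.enorm_conj, ← ofReal_norm, hgn, ← ENNReal.ofReal_rpow_of_nonneg (norm_nonneg _)
      (by linarith), ofReal_norm, ← ENNReal.rpow_mul, hpq.sub_one_mul_conj]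
  rw [hgI] at hb
  have hfin : I ≤ (C * (∫⁻ x, ‖f x‖ₑ ^ p) ^ (1 / p)) * I ^ (1 / q) := by
    refine (hmain.trans hHol).trans ?_
    rw [mul_comm C, mul_assoc]
    gcongr
  rw [eLpNorm_ofReal_eq hp0, eLpNorm_ofReal_eq hp0]
  change I ^ (1 / p) ≤ _
  by_cases hI0 : I = 0
  · rw [hI0, ENNReal.zero_rpow_of_pos (by positivity)]; exact zero_le
  have hs : I = I ^ (1 / p) * I ^ (1 / q) := by
    rw [← ENNReal.rpow_add _ _ hI0 hItop, hpq.one_div_add_one_div]; simp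
  rw [hs] at hfin
  have hne0 : I ^ (1 / q) ≠ 0 := by simp [ENNReal.rpow_eq_zero_iff, hI0, hItop]
  have hnt : I ^ (1 / q) ≠ ⊤ := ENNReal.rpow_ne_top_of_nonneg (by positivity) hItop
  rw [← hs] at hfin
  exact (ENNReal.mul_le_mul_iff_left hne0 hnt).1 (hs ▸ hfin)

/-- The convolution kernel of the multiplier `halfLineSymbol a b`. -/
def halfLineKernel (a b s : ℝ) : ℂ := (2 * π : ℂ)⁻¹ * (cauchyKernel a s - cauchyKernel b s)

/-- A continuous integrable symbol on the half line `0 < ξ`. -/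
def halfLineSymbol (a b ξ : ℝ) : ℂ :=
  (Real.exp (-(2 * π * a) * max ξ 0) : ℂ) - (Real.exp (-(2 * π * b) * max ξ 0) : ℂ)

theorem continuous_halfLineKernel {a b : ℝ} (ha : 0 < a) (hb : 0 < b) :
    Continuous (halfLineKernel a b) :=
  continuous_const.mul ((continuous_cauchyKernel ha).sub (continuous_cauchyKernel hb))

theorem ofReal_add_mul_I_ne_zero {y : ℝ} (hy : 0 < y) (s : ℝ) : (s + y * Complex.I : ℂ) ≠ 0 := by
  intro h
  have := congrArg Complex.im h
  simp at this; linarith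

theorem norm_cauchyKernel_sq (y s : ℝ) :
    ‖cauchyKernel y s‖ ^ 2 = (s ^ 2 + y ^ 2)⁻¹ := by
  rw [cauchyKernel, norm_div, Complex.norm_I, div_pow, one_pow, ← Complex.normSq_eq_norm_sq,
    Complex.normSq_add_mul_I, one_div]

theorem integrable_inv_sq_add_sq {y : ℝ} (hy : 0 < y) :
    Integrable fun s : ℝ => (s ^ 2 + y ^ 2)⁻¹ := by
  have h1 : ∀ s : ℝ, (s ^ 2 + y ^ 2)⁻¹ = (y ^ 2)⁻¹ * (1 + (s / y) ^ 2)⁻¹ := fun s => by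
    field_simp; ring
  simp_rw [h1]
  exact (integrable_inv_one_add_sq.comp_div hy.ne').const_mul _

theorem cauchyKernel_sub {a b : ℝ} (ha : 0 < a) (hb : 0 < b) (s : ℝ) :
    cauchyKernel a s - cauchyKernel b s = (b - a) * (cauchyKernel a s * cauchyKernel b s) := by
  have h1 := ofReal_add_mul_I_ne_zero ha s
  have h2 := ofReal_add_mul_I_ne_zero hb s
  rw [cauchyKernel, cauchyKernel, div_sub_div _ _ h1 h2, div_mul_div_comm, ← mul_div_assoc]
  congr 1
  ring

theorem integrable_halfLineKernel {a b : ℝ} (ha : 0 < a) (hb : 0 < b) :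
    Integrable (halfLineKernel a b) := by
  refine Integrable.const_mul ?_ _
  refine (((integrable_inv_sq_add_sq ha).add (integrable_inv_sq_add_sq hb)).const_mul |b - a|).mono'
    ((continuous_cauchyKernel ha).sub (continuous_cauchyKernel hb)).aestronglyMeasurable
    (Filter.Eventually.of_forall fun s => ?_)
  rw [cauchyKernel_sub ha hb, norm_mul, norm_mul, ← Complex.ofReal_sub, Complex.norm_real,
    Real.norm_eq_abs]
  gcongr
  rw [Pi.add_apply, ← norm_cauchyKernel_sq a, ← norm_cauchyKernel_sq b]
  nlinarith [sq_nonneg (‖cauchyKernel a s‖ - ‖cauchyKernel b s‖), sq_nonneg (‖cauchyKernel a s‖),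
    sq_nonneg (‖cauchyKernel b s‖)]

theorem cauchyKernel_neg (y s : ℝ) :
    cauchyKernel y (-s) = (starRingEnd ℂ) (cauchyKernel y s) := by
  rw [cauchyKernel, cauchyKernel, map_div₀, map_add, map_mul, Complex.conj_I, Complex.conj_ofReal,
    Complex.conj_ofReal, ← neg_div_neg_eq Complex.I]
  push_cast
  congr 1
  ring

theorem halfLineKernel_neg (a b s : ℝ) :
    halfLineKernel a b (-s) = (starRingEnd ℂ) (halfLineKernel a b s) := by
  rw [halfLineKernel, halfLineKernel, cauchyKernel_neg, cauchyKernel_neg, map_mul, map_sub, map_inv₀,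
    map_mul, Complex.conj_ofReal, map_ofNat]

theorem exists_eLpNorm_halfLine_le_of_le_two {p : ℝ} (hp : 1 < p) (hp2 : p ≤ 2) :
    ∃ C : ℝ≥0, ∀ a b : ℝ, 0 < a → 0 < b → ∀ f : ℝ → ℂ, Measurable f → (∃ B, ∀ t, ‖f t‖ ≤ B) →
      eLpNorm (lineConv (halfLineKernel a b) f) (ENNReal.ofReal p) volume ≤
        C * eLpNorm f (ENNReal.ofReal p) volume := by
  obtain ⟨C, hC⟩ := exists_eLpNorm_cauchyConv_le_of_le_two hp hp2
  refine ⟨‖(2 * π : ℂ)⁻¹‖₊ * (C + C), fun a b ha hb f hf ⟨B, hB⟩ => ?_⟩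
  refine eLpNorm_lineConv_le_of_compact (continuous_halfLineKernel ha hb).measurable
    (integrable_halfLineKernel ha hb) (fun f hf hfi hB hR => ?_) hf hB
  have hm : ∀ y : ℝ, 0 < y → AEStronglyMeasurable (cauchyConv y f) volume := fun y hy => by
    have : cauchyConv y f = lineConv (cauchyKernel y) f :=
      funext fun x => (lineConv_eq _ _ x).symm
    rw [this]
    exact (measurable_lineConv (continuous_cauchyKernel hy).measurable hf).aestronglyMeasurable
  have e : lineConv (halfLineKernel a b) f =
      (2 * π : ℂ)⁻¹ • (cauchyConv a f - cauchyConv b f) := by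
    funext x
    rw [lineConv_eq, Pi.smul_apply, Pi.sub_apply, cauchyConv, cauchyConv,
      ← integral_sub (integrable_mul_cauchyKernel ha hfi x) (integrable_mul_cauchyKernel hb hfi x),
      smul_eq_mul, ← integral_const_mul]
    congr with t
    rw [halfLineKernel]
    ring
  rw [e, eLpNorm_const_smul]
  push_cast
  rw [mul_assoc, enorm_eq_nnnorm, add_mul]
  gcongr
  exact (eLpNorm_sub_le (hm a ha) (hm b hb) (by simpa using hp.le)).trans
    (add_le_add (hC a ha f hf hfi hR) (hC b hb f hf hfi hR))

/-- M. Riesz's theorem for smoothed half-line projections. -/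
theorem exists_eLpNorm_halfLine_le {p : ℝ} (hp : 1 < p) :
    ∃ C : ℝ≥0, ∀ a b : ℝ, 0 < a → 0 < b → ∀ f : ℝ → ℂ, Measurable f → (∃ B, ∀ t, ‖f t‖ ≤ B) →
      eLpNorm (lineConv (halfLineKernel a b) f) (ENNReal.ofReal p) volume ≤
        C * eLpNorm f (ENNReal.ofReal p) volume := by
  rcases le_total p 2 with hp2 | hp2
  · exact exists_eLpNorm_halfLine_le_of_le_two hp hp2
  have hpq := Real.HolderConjugate.conjExponent hp
  have hq2 : p.conjExponent ≤ 2 := by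
    rw [Real.conjExponent, div_le_iff₀ (by linarith)]; linarith
  obtain ⟨C, hC⟩ := exists_eLpNorm_halfLine_le_of_le_two hpq.symm.lt hq2
  refine ⟨C, fun a b ha hb f hf ⟨B, hB⟩ => ?_⟩
  have hKm := (continuous_halfLineKernel ha hb).measurable
  have hK := integrable_halfLineKernel ha hb
  refine eLpNorm_lineConv_le_of_compact hKm hK (fun f hf hfi ⟨B, hB⟩ hR => ?_) hf hB
  exact eLpNorm_lineConv_le_dual hKm hK (halfLineKernel_neg a b) hpq (hC a b ha hb) hp2 hf hfi hB

theorem halfLineSymbol_of_nonpos (a b : ℝ) {ξ : ℝ} (h : ξ ≤ 0) : halfLineSymbol a b ξ = 0 := by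
  simp [halfLineSymbol, max_eq_right h]

theorem halfLineSymbol_of_pos (a b : ℝ) {ξ : ℝ} (h : 0 < ξ) : halfLineSymbol a b ξ =
    (Real.exp (-(2 * π * a) * ξ) : ℂ) - (Real.exp (-(2 * π * b) * ξ) : ℂ) := by
  rw [halfLineSymbol, max_eq_left h.le]

theorem continuous_halfLineSymbol (a b : ℝ) : Continuous (halfLineSymbol a b) := by
  unfold halfLineSymbol; fun_prop

theorem halfLineSymbol_mul_eq_indicator (a b : ℝ) (g : ℝ → ℂ) :
    (fun ξ => g ξ * halfLineSymbol a b ξ) = (Set.Ioi 0).indicator fun ξ : ℝ =>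
      g ξ * ((Real.exp (-(2 * π * a) * ξ) : ℂ) - (Real.exp (-(2 * π * b) * ξ) : ℂ)) := by
  funext ξ
  by_cases h : 0 < ξ
  · rw [Set.indicator_of_mem (Set.mem_Ioi.2 h), halfLineSymbol_of_pos a b h]
  · rw [Set.indicator_of_notMem (by simpa using h), halfLineSymbol_of_nonpos a b (not_lt.1 h),
      mul_zero]

theorem exp_line_integral {y : ℝ} (hy : 0 < y) (s : ℝ) :
    IntegrableOn (fun ξ : ℝ => Complex.exp (2 * π * (s * ξ) * Complex.I) *
      (Real.exp (-(2 * π * y) * ξ) : ℂ)) (Set.Ioi 0) ∧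
    ∫ ξ in Set.Ioi (0:ℝ), Complex.exp (2 * π * (s * ξ) * Complex.I) *
      (Real.exp (-(2 * π * y) * ξ) : ℂ) = (2 * π : ℂ)⁻¹ * cauchyKernel y s := by
  have e : ∀ ξ : ℝ, Complex.exp (2 * π * (s * ξ) * Complex.I) * (Real.exp (-(2 * π * y) * ξ) : ℂ) =
      Complex.exp ((2 * π * Complex.I * (s + y * Complex.I)) * ξ) := fun ξ => by
    rw [Complex.ofReal_exp, ← Complex.exp_add]
    congr 1
    push_cast
    linear_combination (-2 * π * y * ξ : ℂ) * Complex.I_sq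
  have hre : (2 * π * Complex.I * (s + y * Complex.I) : ℂ).re < 0 := by
    have : (2 * π * Complex.I * (s + y * Complex.I) : ℂ).re = - (2 * π * y) := by simp
    rw [this]
    have := pi_pos
    simp; positivity
  simp_rw [e]
  refine ⟨integrableOn_exp_mul_complex_Ioi hre 0, ?_⟩
  rw [integral_exp_mul_complex_Ioi hre, cauchyKernel]
  have h1 := ofReal_add_mul_I_ne_zero hy s
  have h2 : (π : ℂ) ≠ 0 := by exact_mod_cast pi_ne_zero
  have h3 := Complex.I_ne_zero
  simp only [Complex.ofReal_zero, mul_zero, Complex.exp_zero]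
  field_simp
  rw [Complex.I_sq, neg_div]

theorem integrable_halfLineSymbol {a b : ℝ} (ha : 0 < a) (hb : 0 < b) :
    Integrable (halfLineSymbol a b) := by
  have h := halfLineSymbol_mul_eq_indicator a b fun _ => 1
  simp only [one_mul] at h
  change Integrable fun ξ => halfLineSymbol a b ξ
  rw [h, integrable_indicator_iff measurableSet_Ioi]
  have h1 := (exp_line_integral ha 0).1
  have h2 := (exp_line_integral hb 0).1
  simp only [Complex.ofReal_zero, zero_mul, mul_zero, Complex.exp_zero, one_mul] at h1 h2
  exact h1.sub h2

theorem fourierInv_halfLineSymbol {a b : ℝ} (ha : 0 < a) (hb : 0 < b) :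
    𝓕⁻ (halfLineSymbol a b) = halfLineKernel a b := by
  funext s
  rw [Real.fourierInv_eq']
  have h := halfLineSymbol_mul_eq_indicator a b fun ξ => Complex.exp (2 * π * (s * ξ) * Complex.I)
  have : ∀ ξ : ℝ, Complex.exp (((2 * π * inner ℝ ξ s : ℝ) : ℂ) * Complex.I) • halfLineSymbol a b ξ =
      Complex.exp (2 * π * (s * ξ) * Complex.I) * halfLineSymbol a b ξ := fun ξ => by
    rw [smul_eq_mul]; congr 3; simp
  simp_rw [this]
  rw [h, integral_indicator measurableSet_Ioi]
  simp_rw [mul_sub]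
  obtain ⟨i1, e1⟩ := exp_line_integral ha s
  obtain ⟨i2, e2⟩ := exp_line_integral hb s
  rw [integral_sub i1 i2, e1, e2, halfLineKernel, mul_sub]

theorem fourier_halfLineKernel {a b : ℝ} (ha : 0 < a) (hb : 0 < b) :
    𝓕 (halfLineKernel a b) = halfLineSymbol a b := by
  rw [← fourierInv_halfLineSymbol ha hb]
  refine (continuous_halfLineSymbol a b).fourier_fourierInv_eq (integrable_halfLineSymbol ha hb) ?_
  have h := (integrable_halfLineKernel ha hb).comp_neg
  rw [← fourierInv_halfLineSymbol ha hb] at h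
  refine h.congr (Filter.Eventually.of_forall fun x => ?_)
  simp only
  rw [fourierInv_eq_fourier_neg, neg_neg]

theorem continuous_fourierInv {d : ℕ} {U : Rd d → ℂ} (hU : Integrable U) : Continuous (𝓕⁻ U) := by
  have : 𝓕⁻ U = fun w => 𝓕 U (-w) := funext fun w => fourierInv_eq_fourier_neg U w
  rw [this]
  exact (VectorFourier.fourierIntegral_continuous Real.continuous_fourierChar
    (innerSL ℝ).continuous₂ hU).comp continuous_neg

theorem norm_fourierInv_le {d : ℕ} (U : Rd d → ℂ) (x : Rd d) : ‖𝓕⁻ U x‖ ≤ ∫ ξ, ‖U ξ‖ := by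
  rw [Real.fourierInv_eq]
  refine (norm_integral_le_integral_norm _).trans_eq ?_
  simp

theorem integral_kernel_mul_fourierInv {d : ℕ} (i : Fin d) {K : ℝ → ℂ} (hK : Integrable K)
    {U : Rd d → ℂ} (hU : Integrable U) (x : Rd d) :
    ∫ t, K t * 𝓕⁻ U (x - t • EuclideanSpace.single i (1 : ℝ)) =
      𝓕⁻ (fun ξ => 𝓕 K (ξ i) * U ξ) x := by
  have hInteg : Integrable (Function.uncurry fun (t : ℝ) (ξ : Rd d) =>
      K t * ((𝐞 (inner ℝ ξ (x - t • EuclideanSpace.single i (1 : ℝ))) : ℂ) * U ξ))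
      (volume.prod volume) := by
    have h1 := hK.mul_prod hU
    refine h1.mono ?_ (Filter.Eventually.of_forall fun z => ?_)
    · have hc : Continuous fun z : ℝ × Rd d =>
          (𝐞 (inner ℝ z.2 (x - z.1 • EuclideanSpace.single i (1 : ℝ))) : ℂ) := by
        refine continuous_subtype_val.comp (Real.continuous_fourierChar.comp ?_)
        fun_prop
      have := hc.aestronglyMeasurable.mul h1.1
      refine this.congr (Filter.Eventually.of_forall fun z => ?_)
      simp only [Function.uncurry, Pi.mul_apply]
      ring
    · simp [Function.uncurry, Circle.norm_coe]
  calc ∫ t, K t * 𝓕⁻ U (x - t • EuclideanSpace.single i (1 : ℝ))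
      = ∫ t, ∫ ξ, K t * ((𝐞 (inner ℝ ξ (x - t • EuclideanSpace.single i (1 : ℝ))) : ℂ) * U ξ) := by
        congr with t
        rw [Real.fourierInv_eq, ← integral_const_mul]
        rfl
    _ = ∫ ξ, ∫ t, K t * ((𝐞 (inner ℝ ξ (x - t • EuclideanSpace.single i (1 : ℝ))) : ℂ) * U ξ) :=
        integral_integral_swap hInteg
    _ = _ := by
        rw [Real.fourierInv_eq]
        congr with ξ
        rw [Real.fourier_real_eq, ← integral_mul_const, Circle.smul_def, smul_eq_mul,
          ← integral_const_mul]
        congr with t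
        rw [inner_sub_right, inner_smul_right, EuclideanSpace.inner_single_right, sub_eq_add_neg,
          AddChar.map_add_eq_mul, Circle.smul_def, smul_eq_mul]
        simp
        ring

theorem eLpNorm_integral_direction_le {d : ℕ} (i : Fin d) {p : ℝ} (hp : 0 < p) {C : ℝ≥0}
    {K : ℝ → ℂ} (hKm : Measurable K)
    (hK : ∀ f : ℝ → ℂ, Measurable f → (∃ B, ∀ t, ‖f t‖ ≤ B) →
      eLpNorm (lineConv K f) (ENNReal.ofReal p) volume ≤ C * eLpNorm f (ENNReal.ofReal p) volume)
    {g : Rd d → ℂ} (hg : Measurable g) {B : ℝ} (hB : ∀ x, ‖g x‖ ≤ B) :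
    eLpNorm (fun x => ∫ t, K t * g (x - t • EuclideanSpace.single i (1 : ℝ)))
      (ENNReal.ofReal p) volume ≤ C * eLpNorm g (ENNReal.ofReal p) volume := by
  set G : Rd d → ℂ := fun x => ∫ t, K t * g (x - t • EuclideanSpace.single i (1 : ℝ)) with hG
  have hGm : Measurable G := by
    have : StronglyMeasurable (Function.uncurry fun (x : Rd d) (t : ℝ) =>
        K t * g (x - t • EuclideanSpace.single i (1 : ℝ))) := by
      apply Measurable.stronglyMeasurable
      refine (hKm.comp measurable_snd).mul (hg.comp ?_)
      exact (by fun_prop : Continuous fun z : Rd d × ℝ =>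
        z.1 - z.2 • (EuclideanSpace.single i (1 : ℝ) : Rd d)).measurable
    exact this.integral_prod_right.measurable
  rw [eLpNorm_ofReal_eq hp, eLpNorm_ofReal_eq hp]
  have hC : (C : ℝ≥0∞) = ((C : ℝ≥0∞) ^ p) ^ (1 / p) := by
    rw [← ENNReal.rpow_mul, mul_one_div_cancel hp.ne', ENNReal.rpow_one]
  rw [hC, ← ENNReal.mul_rpow_of_nonneg _ _ (by positivity)]
  gcongr
  have hmp := PiLp.volume_preserving_toLp (Fin d)
  have hgm' : Measurable fun x : Rd d => (C : ℝ≥0∞) ^ p * ‖g x‖ₑ ^ p :=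
    (hg.enorm.pow_const p).const_mul _
  rw [← lintegral_const_mul _ (hg.enorm.pow_const p), ← hmp.lintegral_comp (hGm.enorm.pow_const p),
    ← hmp.lintegral_comp hgm']
  refine lintegral_le_of_lmarginal_le (μ := fun _ => volume) {i}
    ((hGm.enorm.pow_const p).comp hmp.measurable) (hgm'.comp hmp.measurable) ?_
  rw [lmarginal_singleton, lmarginal_singleton]
  intro x
  set h : ℝ → ℂ := fun s => g (WithLp.toLp 2 (Function.update x i s)) with hh
  have hhm : Measurable h := hg.comp (hmp.measurable.comp (measurable_update x))
  have e : ∀ s, G (WithLp.toLp 2 (Function.update x i s)) = lineConv K h s := fun s => by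
    simp only [hG, lineConv, hh]
    congr with t
    congr 2
    ext k
    by_cases hk : k = i
    · subst hk; simp
    · simp [hk]
  have hb := hK h hhm ⟨B, fun t => hB _⟩
  rw [eLpNorm_ofReal_eq hp, eLpNorm_ofReal_eq hp, hC, ← ENNReal.mul_rpow_of_nonneg _ _ (by positivity),
    ENNReal.rpow_le_rpow_iff (by positivity), ← lintegral_const_mul _ (hhm.enorm.pow_const p)] at hb
  simp only
  simp_rw [e]
  exact hb

/-- `m` acts as a Fourier multiplier on `L^p` with norm at most `C`, tested on functions with
integrable Fourier transform. -/
structure IsLpMultiplier {d : ℕ} (p : ℝ≥0∞) (C : ℝ≥0) (m : Rd d → ℂ) : Prop where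
  measurable : Measurable m
  bounded : ∃ B, ∀ ξ, ‖m ξ‖ ≤ B
  bound : ∀ U : Rd d → ℂ, Integrable U →
    eLpNorm (𝓕⁻ fun ξ => m ξ * U ξ) p volume ≤ C * eLpNorm (𝓕⁻ U) p volume

namespace IsLpMultiplier

variable {d : ℕ} {p : ℝ≥0∞} {C D : ℝ≥0} {m n : Rd d → ℂ}

theorem integrable (h : IsLpMultiplier p C m) {U : Rd d → ℂ} (hU : Integrable U) :
    Integrable fun ξ => m ξ * U ξ := by
  obtain ⟨B, hB⟩ := h.bounded
  exact hU.bdd_mul (c := B) h.measurable.aestronglyMeasurable (Filter.Eventually.of_forall hB)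

theorem one : IsLpMultiplier (d := d) p 1 fun _ => 1 :=
  ⟨measurable_const, ⟨1, fun _ => by simp⟩, fun U _ => by simp⟩

theorem mul (hm : IsLpMultiplier p C m) (hn : IsLpMultiplier p D n) :
    IsLpMultiplier p (C * D) fun ξ => m ξ * n ξ := by
  refine ⟨hm.measurable.mul hn.measurable, ?_, fun U hU => ?_⟩
  · obtain ⟨B, hB⟩ := hm.bounded
    obtain ⟨B', hB'⟩ := hn.bounded
    exact ⟨B * B', fun ξ => by
      rw [norm_mul]
      exact mul_le_mul (hB ξ) (hB' ξ) (norm_nonneg _) ((norm_nonneg _).trans (hB ξ))⟩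
  · have h1 := hm.bound _ (hn.integrable hU)
    simp_rw [← mul_assoc] at h1
    refine h1.trans ?_
    rw [ENNReal.coe_mul, mul_assoc]
    gcongr
    exact hn.bound U hU

theorem add (hp : 1 ≤ p) (hm : IsLpMultiplier p C m) (hn : IsLpMultiplier p D n) :
    IsLpMultiplier p (C + D) fun ξ => m ξ + n ξ := by
  refine ⟨hm.measurable.add hn.measurable, ?_, fun U hU => ?_⟩
  · obtain ⟨B, hB⟩ := hm.bounded
    obtain ⟨B', hB'⟩ := hn.bounded
    exact ⟨B + B', fun ξ => (norm_add_le _ _).trans (add_le_add (hB ξ) (hB' ξ))⟩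
  · have i1 := hm.integrable hU
    have i2 := hn.integrable hU
    have e : (𝓕⁻ fun ξ => (m ξ + n ξ) * U ξ) =
        (𝓕⁻ fun ξ => m ξ * U ξ) + 𝓕⁻ fun ξ => n ξ * U ξ := by
      funext x
      rw [Pi.add_apply, Real.fourierInv_eq, Real.fourierInv_eq, Real.fourierInv_eq, ← integral_add]
      · congr with ξ
        rw [← smul_add, add_mul]
      · exact (Real.fourierIntegral_convergent_iff (-x)).2 i1 |>.congr (by simp)
      · exact (Real.fourierIntegral_convergent_iff (-x)).2 i2 |>.congr (by simp)
    rw [e]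
    refine (eLpNorm_add_le (continuous_fourierInv i1).aestronglyMeasurable
      (continuous_fourierInv i2).aestronglyMeasurable hp).trans ?_
    rw [ENNReal.coe_add, add_mul]
    exact add_le_add (hm.bound U hU) (hn.bound U hU)

theorem neg (hm : IsLpMultiplier p C m) : IsLpMultiplier p C fun ξ => - m ξ := by
  refine ⟨hm.measurable.neg, ?_, fun U hU => ?_⟩
  · obtain ⟨B, hB⟩ := hm.bounded
    exact ⟨B, fun ξ => by rw [norm_neg]; exact hB ξ⟩
  · have e : (𝓕⁻ fun ξ => -m ξ * U ξ) = -(𝓕⁻ fun ξ => m ξ * U ξ) := by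
      funext x
      rw [Pi.neg_apply, Real.fourierInv_eq, Real.fourierInv_eq, ← integral_neg]
      congr with ξ
      rw [neg_mul, smul_neg]
    rw [e, eLpNorm_neg]
    exact hm.bound U hU

theorem sub (hp : 1 ≤ p) (hm : IsLpMultiplier p C m) (hn : IsLpMultiplier p D n) :
    IsLpMultiplier p (C + D) fun ξ => m ξ - n ξ := by
  simp_rw [sub_eq_add_neg]
  exact hm.add hp hn.neg

theorem prod {ι : Type*} (s : Finset ι) {C : ℝ≥0} {m : ι → Rd d → ℂ}
    (h : ∀ i ∈ s, IsLpMultiplier p C (m i)) :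
    IsLpMultiplier p (C ^ s.card) fun ξ => ∏ i ∈ s, m i ξ := by
  classical
  induction s using Finset.induction_on with
  | empty => simpa using one
  | insert i s hi ih =>
    simp_rw [Finset.prod_insert hi]
    rw [Finset.card_insert_of_notMem hi, pow_succ']
    exact (h i (by simp)).mul (ih fun j hj => h j (by simp [hj]))

/-- Multipliers are stable under bounded pointwise limits. -/
theorem of_tendsto {f : ℕ → Rd d → ℂ} (hf : ∀ n, IsLpMultiplier p C (f n)) {B : ℝ}
    (hB : ∀ n ξ, ‖f n ξ‖ ≤ B)
    (hlim : ∀ ξ, Filter.Tendsto (fun n => f n ξ) Filter.atTop (nhds (m ξ))) :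
    IsLpMultiplier p C m := by
  refine ⟨measurable_of_tendsto_metrizable (fun n => (hf n).measurable) (tendsto_pi_nhds.2 hlim),
    ⟨B, fun ξ => le_of_tendsto (hlim ξ).norm (Filter.Eventually.of_forall fun n => hB n ξ)⟩,
    fun U hU => ?_⟩
  refine (Lp.eLpNorm_lim_le_liminf_eLpNorm
    (fun n => (continuous_fourierInv ((hf n).integrable hU)).aestronglyMeasurable) _
    (Filter.Eventually.of_forall fun x => ?_)).trans
    (Filter.liminf_le_of_frequently_le' (Filter.Frequently.of_forall fun n => (hf n).bound U hU))
  simp_rw [Real.fourierInv_eq]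
  refine tendsto_integral_of_dominated_convergence (fun ξ => B * ‖U ξ‖) (fun n => ?_)
    (hU.norm.const_mul B) (fun n => Filter.Eventually.of_forall fun ξ => ?_)
    (Filter.Eventually.of_forall fun ξ => ((hlim ξ).mul_const _).const_smul _)
  · have := ((Real.fourierIntegral_convergent_iff (-x)).2 ((hf n).integrable hU)).1
    simpa using this
  · rw [Circle.norm_smul, norm_mul]
    gcongr
    exact hB n ξ

/-- Reflection of a multiplier. -/
theorem comp_neg (hm : IsLpMultiplier p C m) : IsLpMultiplier p C fun ξ => m (-ξ) := by
  refine ⟨hm.measurable.comp measurable_neg, ?_, fun U hU => ?_⟩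
  · obtain ⟨B, hB⟩ := hm.bounded
    exact ⟨B, fun ξ => hB _⟩
  · have e : ∀ V : Rd d → ℂ, 𝓕⁻ V = fun x => 𝓕⁻ (fun ξ => V (-ξ)) (-x) := fun V => by
      funext x
      rw [fourierInv_eq_fourier_comp_neg, fourierInv_eq_fourier_neg, neg_neg]
    have hb := hm.bound (fun ξ => U (-ξ)) hU.comp_neg
    have hmp : MeasurePreserving (fun x : Rd d => -x) volume volume :=
      Measure.measurePreserving_neg volume
    have hl : ∀ V : Rd d → ℂ, Integrable V →
        eLpNorm (𝓕⁻ V) p volume = eLpNorm (𝓕⁻ fun ξ => V (-ξ)) p volume := fun V hV => by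
      rw [e V]
      exact eLpNorm_comp_measurePreserving
        (continuous_fourierInv hV.comp_neg).aestronglyMeasurable hmp
    have hmU : Integrable fun ξ => m (-ξ) * U ξ := by
      simpa using (hm.integrable hU.comp_neg).comp_neg
    rw [hl _ hmU, hl U hU]
    simpa using hb

end IsLpMultiplier

theorem norm_halfLineSymbol_le {a b : ℝ} (ha : 0 < a) (hb : 0 < b) (ξ : ℝ) :
    ‖halfLineSymbol a b ξ‖ ≤ 2 := by
  have h : ∀ y : ℝ, 0 < y → ‖(Real.exp (-(2 * π * y) * max ξ 0) : ℂ)‖ ≤ 1 := fun y hy => by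
    rw [Complex.norm_real, Real.norm_of_nonneg (Real.exp_pos _).le, Real.exp_le_one_iff]
    have : 0 ≤ 2 * π * y * max ξ 0 := by positivity
    linarith
  exact (norm_sub_le _ _).trans ((add_le_add (h a ha) (h b hb)).trans (by norm_num))

theorem exists_isLpMultiplier_halfLine (d : ℕ) {p : ℝ} (hp : 1 < p) :
    ∃ C : ℝ≥0, ∀ (i : Fin d) (σ : ℝ), 0 ≤ σ →
      IsLpMultiplier (d := d) (ENNReal.ofReal p) C
        (fun ξ => if 0 < ξ i then (Real.exp (-(σ * ξ i)) : ℂ) else 0) := by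
  obtain ⟨C, hC⟩ := exists_eLpNorm_halfLine_le hp
  have hmult : ∀ (i : Fin d) (a b : ℝ), 0 < a → 0 < b →
      IsLpMultiplier (d := d) (ENNReal.ofReal p) C fun ξ => halfLineSymbol a b (ξ i) := by
    intro i a b ha hb
    refine ⟨(continuous_halfLineSymbol a b).measurable.comp (by fun_prop), ⟨2, fun ξ => ?_⟩,
      fun U hU => ?_⟩
    · exact norm_halfLineSymbol_le ha hb _
    · have := eLpNorm_integral_direction_le i (by linarith : 0 < p)
        (continuous_halfLineKernel ha hb).measurable (hC a b ha hb)
        (continuous_fourierInv hU).measurable (norm_fourierInv_le U)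
      simp_rw [integral_kernel_mul_fourierInv i (integrable_halfLineKernel ha hb) hU,
        fourier_halfLineKernel ha hb] at this
      exact this
  refine ⟨C, fun i σ hσ => ?_⟩
  have ha : ∀ n : ℕ, 0 < σ / (2 * π) + 1 / ((n : ℝ) + 1) := fun n => by positivity
  have hb : ∀ n : ℕ, 0 < (n : ℝ) + 1 := fun n => by positivity
  refine IsLpMultiplier.of_tendsto (fun n : ℕ => hmult i _ _ (ha n) (hb n))
    (fun n ξ => norm_halfLineSymbol_le (ha n) (hb n) _) fun ξ => ?_
  split_ifs with h
  · simp_rw [halfLineSymbol_of_pos _ _ h]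
    rw [← sub_zero (Real.exp (-(σ * ξ i)) : ℂ)]
    have hn : Filter.Tendsto (fun n : ℕ => (n : ℝ) + 1) Filter.atTop Filter.atTop :=
      Filter.tendsto_atTop_add_const_right _ _ tendsto_natCast_atTop_atTop
    refine Filter.Tendsto.sub ?_ ?_
    · refine (Complex.continuous_ofReal.tendsto _).comp ((Real.continuous_exp.tendsto _).comp ?_)
      have h1 := (tendsto_one_div_add_atTop_nhds_zero_nat (𝕜 := ℝ)).const_add (σ / (2 * π))
      have h2 := ((h1.const_mul (2 * π)).neg).mul_const (ξ i)
      convert h2 using 2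
      field_simp
      ring
    · rw [← Complex.ofReal_zero]
      refine (Complex.continuous_ofReal.tendsto _).comp (Real.tendsto_exp_atBot.comp ?_)
      have h1 := hn.const_mul_atTop (by positivity : 0 < 2 * π * ξ i)
      refine (Filter.tendsto_neg_atTop_atBot.comp h1).congr fun n => ?_
      simp only [Function.comp_apply]; ring
  · simp_rw [halfLineSymbol_of_nonpos _ _ (not_lt.1 h)]
    exact tendsto_const_nhds

/-- The symbol `1_{0 ≤ ±ξ_i}`, with the boundary put on the positive side. -/
def signCutoff {d : ℕ} (c : Fin d → Bool) (i : Fin d) (ξ : Rd d) : ℂ :=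
  if c i then (if 0 ≤ ξ i then 1 else 0) else (if ξ i < 0 then 1 else 0)

/-- The symbol `e^{τ(±ξ_i - |ξ_i|)}`. -/
def signWeight {d : ℕ} (τ : ℝ) (c : Fin d → Bool) (i : Fin d) (ξ : Rd d) : ℂ :=
  (Real.exp (τ * ((if c i then ξ i else -ξ i) - |ξ i|)) : ℂ)

theorem exists_isLpMultiplier_sign (d : ℕ) {p : ℝ} (hp : 1 < p) :
    ∃ C : ℝ≥0, (∀ (c : Fin d → Bool) (i : Fin d),
        IsLpMultiplier (ENNReal.ofReal p) C (signCutoff c i)) ∧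
      ∀ (τ : ℝ), 0 ≤ τ → ∀ (c : Fin d → Bool) (i : Fin d),
        IsLpMultiplier (ENNReal.ofReal p) C (signWeight τ c i) := by
  obtain ⟨C, hC⟩ := exists_isLpMultiplier_halfLine d hp
  have hp1 : 1 ≤ ENNReal.ofReal p := by simpa using hp.le
  have mono : ∀ {D D' : ℝ≥0} {m m' : Rd d → ℂ}, IsLpMultiplier (ENNReal.ofReal p) D m → m = m' →
      D ≤ D' → IsLpMultiplier (ENNReal.ofReal p) D' m' := by
    rintro D D' m _ h rfl hle
    refine ⟨h.measurable, h.bounded, fun U hU => (h.bound U hU).trans ?_⟩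
    gcongr
  refine ⟨1 + C + C, fun c i => ?_, fun τ hτ c i => ?_⟩
  · cases hc : c i
    · refine mono (hC i 0 le_rfl).comp_neg ?_ (by rw [add_assoc, add_comm, add_assoc]; simp)
      funext ξ
      simp [signCutoff, hc]
    · refine mono (IsLpMultiplier.one.sub hp1 (hC i 0 le_rfl).comp_neg) ?_ (by simp)
      funext ξ
      simp only [signCutoff, hc, if_true]
      by_cases h : 0 ≤ ξ i
      · simp [h, not_lt.2 h]
      · simp [h, not_le.1 h]
  · cases hc : c i
    · refine mono ((IsLpMultiplier.one.sub hp1 (hC i 0 le_rfl)).add hp1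
        (hC i (2 * τ) (by positivity))) ?_ le_rfl
      funext ξ
      simp only [signWeight, hc]
      by_cases h : 0 < ξ i
      · simp only [h, if_true, abs_of_pos h]
        simp
        ring_nf
      · simp [h, abs_of_nonpos (not_lt.1 h)]
    · refine mono ((IsLpMultiplier.one.sub hp1 (hC i 0 le_rfl).comp_neg).add hp1
        (hC i (2 * τ) (by positivity)).comp_neg) ?_ le_rfl
      funext ξ
      simp only [signWeight, hc]
      by_cases h : ξ i < 0
      · simp [h, abs_of_neg h]
        ring_nf
      · simp [h, abs_of_nonneg (not_lt.1 h)]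

/-- Convolution of two functions on frequency space. -/
def freqConv {d : ℕ} (U V : Rd d → ℂ) (ζ : Rd d) : ℂ := ∫ η, U η * V (ζ - η)

theorem integrable_freqConv {d : ℕ} {U V : Rd d → ℂ} (hU : Integrable U) (hV : Integrable V) :
    Integrable (freqConv U V) :=
  hU.integrable_convolution (ContinuousLinearMap.mul ℂ ℂ) hV

theorem continuous_freqConv {d : ℕ} {U V : Rd d → ℂ} (hU : Integrable U) (hV : Continuous V) {B : ℝ}
    (hB : ∀ ξ, ‖V ξ‖ ≤ B) : Continuous (freqConv U V) :=
  BddAbove.continuous_convolution_right_of_integrable (ContinuousLinearMap.mul ℂ ℂ)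
    ⟨B, by rintro _ ⟨ξ, rfl⟩; exact hB ξ⟩ hU hV

theorem fourierInv_freqConv {d : ℕ} {U V : Rd d → ℂ} (hU : Integrable U) (hV : Integrable V)
    (x : Rd d) : 𝓕⁻ (freqConv U V) x = 𝓕⁻ U x * 𝓕⁻ V x := by
  simp_rw [fourierInv_eq_fourier_neg]
  exact Real.fourier_mul_convolution_eq hU hV (-x)

theorem fourierInv_zero {d : ℕ} : 𝓕⁻ (0 : Rd d → ℂ) = 0 := by
  funext x
  simp [Real.fourierInv_eq]

theorem fourier_fourierInv_eq_or_eq_zero {d : ℕ} {W : Rd d → ℂ} (hc : Continuous W)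
    (hW : Integrable W) : 𝓕 (𝓕⁻ W) = W ∨ 𝓕 (𝓕⁻ W) = 0 := by
  by_cases h : Integrable (𝓕⁻ W)
  · left
    refine hc.fourier_fourierInv_eq hW (h.comp_neg.congr (Filter.Eventually.of_forall fun x => ?_))
    simp only
    rw [fourierInv_eq_fourier_neg, neg_neg]
  · right
    funext x
    rw [Real.fourier_eq]
    exact integral_undef fun hi => h ((Real.fourierIntegral_convergent_iff x).1 hi)

theorem prod_signCutoff {d : ℕ} (c : Fin d → Bool) (ζ : Rd d) :
    ∏ i, signCutoff c i ζ = if c = fun i => decide (0 ≤ ζ i) then 1 else 0 := by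
  split_ifs with h
  · refine Finset.prod_eq_one fun i _ => ?_
    by_cases hi : 0 ≤ ζ i
    · simp [signCutoff, h, hi]
    · simp [signCutoff, h, hi, not_le.1 hi]
  · obtain ⟨i, hi⟩ := Function.ne_iff.1 h
    refine Finset.prod_eq_zero (Finset.mem_univ i) ?_
    by_cases hneg : 0 ≤ ζ i
    · simp only [hneg, decide_true, ne_eq, Bool.not_eq_true] at hi
      simp [signCutoff, hi, not_lt.2 hneg]
    · simp only [hneg, decide_false, ne_eq, Bool.not_eq_false] at hi
      simp [signCutoff, hi, hneg]

/-- On each orthant the exponential weight splits as a product. -/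
theorem exp_mul_freqConv_eq_sum {d : ℕ} (τ : ℝ) (U V : Rd d → ℂ) (ζ : Rd d) :
    (Real.exp (τ * ∑ i, |ζ i|) : ℂ) *
        freqConv (fun ξ => (Real.exp (-τ * ∑ i, |ξ i|) : ℂ) * U ξ)
          (fun ξ => (Real.exp (-τ * ∑ i, |ξ i|) : ℂ) * V ξ) ζ =
      ∑ c : Fin d → Bool, (∏ i, signCutoff c i ζ) *
        freqConv (fun ξ => (∏ i, signWeight τ c i ξ) * U ξ)
          (fun ξ => (∏ i, signWeight τ c i ξ) * V ξ) ζ := by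
  simp_rw [prod_signCutoff, ite_mul, zero_mul, one_mul]
  rw [Finset.sum_ite_eq' Finset.univ, if_pos (Finset.mem_univ _)]
  rw [freqConv, freqConv, ← integral_const_mul]
  congr with η
  simp only [signWeight]
  simp_rw [← Complex.ofReal_prod, ← Real.exp_sum]
  have key : Real.exp (τ * ∑ i, |ζ i|) * Real.exp (-τ * ∑ i, |η i|) *
      Real.exp (-τ * ∑ i, |(ζ - η) i|) =
      Real.exp (∑ i, τ * ((if decide (0 ≤ ζ i) then η i else -η i) - |η i|)) *
      Real.exp (∑ i, τ * ((if decide (0 ≤ ζ i) then (ζ - η) i else -(ζ - η) i) - |(ζ - η) i|)) := by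
    rw [← Real.exp_add, ← Real.exp_add, ← Real.exp_add]
    congr 1
    simp_rw [Finset.mul_sum]
    rw [← Finset.sum_add_distrib, ← Finset.sum_add_distrib, ← Finset.sum_add_distrib]
    refine Finset.sum_congr rfl fun i _ => ?_
    by_cases hi : 0 ≤ ζ i
    · simp only [hi, decide_true, if_true, abs_of_nonneg hi, PiLp.sub_apply]; ring
    · simp only [hi, decide_false, abs_of_neg (not_le.1 hi), PiLp.sub_apply]
      simp only [Bool.false_eq_true, if_false]; ring
  have key' := congrArg (fun r : ℝ => (r : ℂ) * (U η * V (ζ - η))) key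
  simp only [Complex.ofReal_mul] at key'
  linear_combination key'

theorem eLpNorm_fourierInv_sum_le {d : ℕ} {p : ℝ≥0∞} (hp : 1 ≤ p) {ι : Type*} (s : Finset ι)
    {F : ι → Rd d → ℂ} (hF : ∀ i ∈ s, Integrable (F i)) :
    eLpNorm (𝓕⁻ fun ξ => ∑ i ∈ s, F i ξ) p volume ≤ ∑ i ∈ s, eLpNorm (𝓕⁻ (F i)) p volume := by
  have e : (𝓕⁻ fun ξ => ∑ i ∈ s, F i ξ) = ∑ i ∈ s, 𝓕⁻ (F i) := by
    funext x
    rw [Finset.sum_apply, Real.fourierInv_eq]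
    simp_rw [Real.fourierInv_eq, Finset.smul_sum]
    refine integral_finsetSum _ fun i hi => ?_
    exact (Real.fourierIntegral_convergent_iff (-x)).2 (hF i hi) |>.congr (by simp)
  rw [e]
  exact eLpNorm_sum_le (fun i hi => (continuous_fourierInv (hF i hi)).aestronglyMeasurable) hp

/-- Reduction of the weighted product to frequency convolutions of `L^p`-multiplied factors. -/
theorem eLpNorm_LPblock_expL1_le {d : ℕ} {φ : Rd d → ℝ} (hφc : Continuous φ) {M : ℝ}
    (hφM : ∀ ξ, |φ ξ| ≤ M) {p : ℝ} (hp : 1 < p) {C : ℝ≥0}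
    (hcut : ∀ (c : Fin d → Bool) (i : Fin d), IsLpMultiplier (ENNReal.ofReal p) C (signCutoff c i))
    {τ : ℝ} (hτ : 0 ≤ τ)
    (hw : ∀ (c : Fin d → Bool) (i : Fin d), IsLpMultiplier (ENNReal.ofReal p) C (signWeight τ c i))
    (A B : 𝓢(Rd d, ℂ)) (j : ℤ) :
    eLpNorm (LPblock d φ j (expL1 d τ (fun x => expL1 d (-τ) (⇑A) x * expL1 d (-τ) (⇑B) x)))
        (ENNReal.ofReal p) volume ≤
      ∑ c : Fin d → Bool, (C ^ d : ℝ≥0) *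
        eLpNorm (𝓕⁻ fun ζ => (φ (((2:ℝ) ^ (-j)) • ζ) : ℂ) *
          freqConv (fun ξ => (∏ i, signWeight τ c i ξ) * 𝓕 (⇑A) ξ)
            (fun ξ => (∏ i, signWeight τ c i ξ) * 𝓕 (⇑B) ξ) ζ) (ENNReal.ofReal p) volume := by
  have hp1 : 1 ≤ ENNReal.ofReal p := by simpa using hp.le
  have hpl : Continuous fun ξ : Rd d => (Real.exp (-τ * ∑ i, |ξ i|) : ℂ) := by fun_prop
  have hpl1 : ∀ ξ : Rd d, ‖(Real.exp (-τ * ∑ i, |ξ i|) : ℂ)‖ ≤ 1 := fun ξ => by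
    rw [Complex.norm_real, Real.norm_of_nonneg (Real.exp_pos _).le, Real.exp_le_one_iff, neg_mul]
    have : 0 ≤ τ * ∑ i, |ξ i| := mul_nonneg hτ (Finset.sum_nonneg fun i _ => abs_nonneg _)
    linarith
  rw [← SchwartzMap.fourier_coe, ← SchwartzMap.fourier_coe]
  set a : 𝓢(Rd d, ℂ) := 𝓕 A with ha
  set b : 𝓢(Rd d, ℂ) := 𝓕 B with hb
  set U : Rd d → ℂ := fun ξ => (Real.exp (-τ * ∑ i, |ξ i|) : ℂ) * a ξ with hU
  set V : Rd d → ℂ := fun ξ => (Real.exp (-τ * ∑ i, |ξ i|) : ℂ) * b ξ with hV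
  have hUi : Integrable U := a.integrable.bdd_mul (c := 1) hpl.aestronglyMeasurable
    (Filter.Eventually.of_forall hpl1)
  have hVi : Integrable V := b.integrable.bdd_mul (c := 1) hpl.aestronglyMeasurable
    (Filter.Eventually.of_forall hpl1)
  have hVc : Continuous V := hpl.mul b.continuous
  have hVB : ∀ ξ, ‖V ξ‖ ≤ ‖b.toBoundedContinuousFunction‖ := fun ξ => by
    simp only [hV]
    rw [norm_mul]
    refine (mul_le_of_le_one_left (norm_nonneg _) (hpl1 ξ)).trans ?_
    exact b.toBoundedContinuousFunction.norm_coe_le_norm ξ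
  have hWi := integrable_freqConv hUi hVi
  have hWc := continuous_freqConv hUi hVc hVB
  have hfg : (fun x => expL1 d (-τ) (⇑A) x * expL1 d (-τ) (⇑B) x) = 𝓕⁻ (freqConv U V) := by
    funext x
    rw [fourierInv_freqConv hUi hVi, expL1, expL1, ← SchwartzMap.fourier_coe,
      ← SchwartzMap.fourier_coe]
  set wt : (Fin d → Bool) → Rd d → ℂ := fun c ξ => ∏ i, signWeight τ c i ξ with hwt
  set ct : (Fin d → Bool) → Rd d → ℂ := fun c ξ => ∏ i, signCutoff c i ξ with hct
  have hwtm : ∀ c, IsLpMultiplier (ENNReal.ofReal p) (C ^ d) (wt c) := fun c => by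
    simpa using IsLpMultiplier.prod Finset.univ fun i _ => hw c i
  have hctm : ∀ c, IsLpMultiplier (ENNReal.ofReal p) (C ^ d) (ct c) := fun c => by
    simpa using IsLpMultiplier.prod Finset.univ fun i _ => hcut c i
  set Wc : (Fin d → Bool) → Rd d → ℂ := fun c =>
    freqConv (fun ξ => wt c ξ * a ξ) (fun ξ => wt c ξ * b ξ) with hWcdef
  have hWci : ∀ c, Integrable (Wc c) := fun c =>
    integrable_freqConv ((hwtm c).integrable a.integrable) ((hwtm c).integrable b.integrable)
  set G : Rd d → ℂ := fun ζ => (Real.exp (τ * ∑ i, |ζ i|) : ℂ) * freqConv U V ζ with hG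
  have hGeq : G = fun ζ => ∑ c : Fin d → Bool, ct c ζ * Wc c ζ :=
    funext fun ζ => exp_mul_freqConv_eq_sum τ (⇑a) (⇑b) ζ
  have hGi : Integrable G := by
    rw [hGeq]
    exact integrable_finsetSum _ fun c _ => (hctm c).integrable (hWci c)
  have hGc : Continuous G := by
    refine Continuous.mul ?_ hWc
    fun_prop
  have hzero : ∀ m : Rd d → ℂ, (fun ξ => m ξ * (0 : Rd d → ℂ) ξ) = 0 := fun m => by
    funext ξ; simp
  rw [hfg, LPblock, expL1]
  rcases fourier_fourierInv_eq_or_eq_zero hWc hWi with h | h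
  swap
  · rw [h, hzero, fourierInv_zero]
    have : 𝓕 (0 : Rd d → ℂ) = 0 := by funext x; simp [Real.fourier_eq]
    rw [this, hzero, fourierInv_zero]
    simp
  rw [h]
  rcases fourier_fourierInv_eq_or_eq_zero hGc hGi with h' | h'
  swap
  · rw [h', hzero, fourierInv_zero]
    simp
  rw [h', hGeq]
  have hφj : Continuous fun ζ : Rd d => (φ (((2:ℝ) ^ (-j)) • ζ) : ℂ) := by fun_prop
  have hInteg : ∀ c, Integrable fun ζ => (φ (((2:ℝ) ^ (-j)) • ζ) : ℂ) * Wc c ζ := fun c =>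
    (hWci c).bdd_mul (c := M) hφj.aestronglyMeasurable (Filter.Eventually.of_forall fun ζ => by
      rw [Complex.norm_real]; exact hφM _)
  have e : (fun ξ => (φ (((2:ℝ) ^ (-j)) • ξ) : ℂ) * ∑ c : Fin d → Bool, ct c ξ * Wc c ξ) =
      fun ξ => ∑ c : Fin d → Bool, ct c ξ * ((φ (((2:ℝ) ^ (-j)) • ξ) : ℂ) * Wc c ξ) := by
    funext ξ
    rw [Finset.mul_sum]
    exact Finset.sum_congr rfl fun c _ => by ring
  rw [e]
  refine (eLpNorm_fourierInv_sum_le hp1 _ fun c _ => (hctm c).integrable (hInteg c)).trans ?_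
  exact Finset.sum_le_sum fun c _ => (hctm c).bound _ (hInteg c)

/-- The profile of a homogeneous Littlewood–Paley decomposition. -/
structure IsDyadicProfile {d : ℕ} (φ : Rd d → ℝ) : Prop where
  smooth : ContDiff ℝ (⊤ : ℕ∞) φ
  supp : ∀ x : Rd d, φ x ≠ 0 → 3/4 ≤ ‖x‖ ∧ ‖x‖ ≤ 8/3
  tsum_eq : ∀ ξ : Rd d, ξ ≠ 0 → ∑' j : ℤ, φ (((2:ℝ) ^ (-j)) • ξ) = 1

/-- The complex-valued dyadic cutoff `φ(2^{-j} ξ)`. -/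
def dyadicCut {d : ℕ} (φ : Rd d → ℝ) (j : ℤ) (ξ : Rd d) : ℂ := (φ (((2:ℝ) ^ (-j)) • ξ) : ℂ)

/-- The convolution kernel of the Littlewood–Paley block. -/
def dyadicKernel {d : ℕ} (φ : Rd d → ℝ) (j : ℤ) : Rd d → ℂ := 𝓕⁻ (dyadicCut φ j)

namespace IsDyadicProfile

variable {d : ℕ} {φ : Rd d → ℝ}

theorem hasCompactSupport (h : IsDyadicProfile φ) : HasCompactSupport φ := by
  refine HasCompactSupport.of_support_subset_isCompact (isCompact_closedBall (0 : Rd d) (8/3)) ?_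
  intro x hx
  simpa using (h.supp x hx).2

theorem exists_bound (h : IsDyadicProfile φ) : ∃ M : ℝ, ∀ x, |φ x| ≤ M := by
  obtain ⟨M, hM⟩ := h.hasCompactSupport.exists_bound_of_continuous h.smooth.continuous
  exact ⟨M, hM⟩

theorem norm_mem (h : IsDyadicProfile φ) {j : ℤ} {ξ : Rd d} (hj : dyadicCut φ j ξ ≠ 0) :
    3/4 * (2:ℝ) ^ j ≤ ‖ξ‖ ∧ ‖ξ‖ ≤ 8/3 * (2:ℝ) ^ j := by
  have hj' : φ (((2:ℝ) ^ (-j)) • ξ) ≠ 0 := fun h0 => hj (by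
    rw [dyadicCut, h0, Complex.ofReal_zero])
  obtain ⟨h1, h2⟩ := h.supp _ hj'
  rw [norm_smul, Real.norm_of_nonneg (by positivity), zpow_neg, inv_mul_eq_div] at h1 h2
  rw [le_div_iff₀ (by positivity)] at h1
  rw [div_le_iff₀ (by positivity)] at h2
  exact ⟨h1, h2⟩

theorem continuous_cut (h : IsDyadicProfile φ) (j : ℤ) : Continuous (dyadicCut φ j) := by
  have := h.smooth.continuous
  unfold dyadicCut
  fun_prop

theorem integrable_cut_mul (h : IsDyadicProfile φ) (j : ℤ) {U : Rd d → ℂ} (hU : Integrable U) :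
    Integrable fun ξ => dyadicCut φ j ξ * U ξ := by
  obtain ⟨M, hM⟩ := h.exists_bound
  exact hU.bdd_mul (c := M) (h.continuous_cut j).aestronglyMeasurable
    (Filter.Eventually.of_forall fun ξ => by rw [dyadicCut, Complex.norm_real]; exact hM _)

theorem abs_sub_le_one (h : IsDyadicProfile φ) {j k : ℤ} {ξ : Rd d} (hj : dyadicCut φ j ξ ≠ 0)
    (hk : dyadicCut φ k ξ ≠ 0) : j ≤ k + 1 := by
  by_contra! hlt
  have h1 := (h.norm_mem hj).1
  have h2 := (h.norm_mem hk).2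
  have h3 : (2:ℝ) ^ (k + 2) ≤ 2 ^ j := zpow_le_zpow_right₀ (by norm_num) (by lia)
  rw [zpow_add₀ (by norm_num)] at h3
  have h4 : (0:ℝ) < 2 ^ k := by positivity
  norm_num at h3
  linarith

theorem sum_cut_near (h : IsDyadicProfile φ) {k : ℤ} {ξ : Rd d} (hk : dyadicCut φ k ξ ≠ 0)
    {s : Finset ℤ} (hs : Finset.Icc (k - 1) (k + 1) ⊆ s) : ∑ l ∈ s, dyadicCut φ l ξ = 1 := by
  have hξ : ξ ≠ 0 := by
    rintro rfl
    have := (h.norm_mem hk).1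
    have h4 : (0:ℝ) < 2 ^ k := by positivity
    rw [norm_zero] at this
    linarith
  have h1 := h.tsum_eq ξ hξ
  rw [tsum_eq_sum (s := s)] at h1
  · rw [← Complex.ofReal_one, ← h1, Complex.ofReal_sum]
    rfl
  · intro l hl
    by_contra hne
    have hl' : dyadicCut φ l ξ ≠ 0 := by simpa [dyadicCut] using hne
    have a1 := h.abs_sub_le_one hl' hk
    have a2 := h.abs_sub_le_one hk hl'
    exact hl (hs (Finset.mem_Icc.2 ⟨by lia, by lia⟩))

theorem exists_cut_ne_zero (h : IsDyadicProfile φ) {ξ : Rd d} (hξ : ξ ≠ 0) :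
    ∃ k, dyadicCut φ k ξ ≠ 0 := by
  by_contra! hk
  have h1 := h.tsum_eq ξ hξ
  have h2 : ∀ k : ℤ, φ (((2:ℝ) ^ (-k)) • ξ) = 0 := fun k => by
    have := hk k
    rw [dyadicCut] at this
    exact_mod_cast this
  simp only [h2, tsum_zero] at h1
  exact zero_ne_one h1

theorem norm_sum_cut_le (h : IsDyadicProfile φ) {M : ℝ} (hM : ∀ x, |φ x| ≤ M) (s : Finset ℤ)
    (ξ : Rd d) : ‖∑ k ∈ s, dyadicCut φ k ξ‖ ≤ 3 * M := by
  have hM0 : 0 ≤ M := (abs_nonneg _).trans (hM 0)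
  by_cases hz : ∀ k, dyadicCut φ k ξ = 0
  · simp only [hz, Finset.sum_const_zero, norm_zero]
    positivity
  push Not at hz
  obtain ⟨k, hk⟩ := hz
  have hsub : ∑ l ∈ s, dyadicCut φ l ξ =
      ∑ l ∈ s.filter (· ∈ Finset.Icc (k - 1) (k + 1)), dyadicCut φ l ξ := by
    refine (Finset.sum_filter_of_ne fun l _ hl => ?_).symm
    have a1 := h.abs_sub_le_one hl hk
    have a2 := h.abs_sub_le_one hk hl
    exact Finset.mem_Icc.2 ⟨by lia, by lia⟩
  rw [hsub]
  refine (norm_sum_le_of_le _ (fun l _ => (by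
    rw [dyadicCut, Complex.norm_real]; exact hM _ : ‖dyadicCut φ l ξ‖ ≤ M))).trans ?_
  rw [Finset.sum_const, nsmul_eq_mul]
  gcongr
  have : (s.filter (· ∈ Finset.Icc (k - 1) (k + 1))).card ≤ (Finset.Icc (k - 1) (k + 1)).card :=
    Finset.card_le_card fun l hl => (Finset.mem_filter.1 hl).2
  rw [Int.card_Icc] at this
  have e : (k + 1 + 1 - (k - 1)).toNat = 3 := by lia
  rw [e] at this
  exact_mod_cast this

theorem tendsto_sum_cut (h : IsDyadicProfile φ) {ξ : Rd d} (hξ : ξ ≠ 0) :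
    ∀ᶠ n : ℕ in Filter.atTop, ∑ k ∈ Finset.Icc (-(n:ℤ)) n, dyadicCut φ k ξ = 1 := by
  obtain ⟨k, hk⟩ := h.exists_cut_ne_zero hξ
  filter_upwards [Filter.eventually_ge_atTop (k.natAbs + 1)] with n hn
  refine h.sum_cut_near hk fun l hl => ?_
  rw [Finset.mem_Icc] at hl ⊢
  exact ⟨by lia, by lia⟩

theorem kernel_scaling (j : ℤ) (x : Rd d) :
    dyadicKernel φ j x = (((2:ℝ) ^ j) ^ d : ℝ) * dyadicKernel φ 0 ((2:ℝ) ^ j • x) := by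
  rw [dyadicKernel, dyadicKernel, Real.fourierInv_eq, Real.fourierInv_eq]
  have h2 : (2:ℝ) ^ (-j) * 2 ^ j = 1 := by
    rw [zpow_neg, inv_mul_cancel₀ (by positivity)]
  have := Measure.integral_comp_smul (volume : Measure (Rd d))
    (fun η => 𝐞 (inner ℝ η ((2:ℝ) ^ j • x)) • dyadicCut φ 0 η) ((2:ℝ) ^ (-j))
  rw [finrank_euclideanSpace_fin, abs_of_nonneg (by positivity)] at this
  rw [show (((2:ℝ) ^ j) ^ d) = (((2:ℝ) ^ (-j)) ^ d)⁻¹ by rw [zpow_neg, inv_pow, inv_inv],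
    ← smul_eq_mul, Complex.coe_smul, ← this]
  congr with ξ
  rw [inner_smul_left, inner_smul_right, ← mul_assoc, RCLike.conj_to_real, h2, one_mul]
  simp [dyadicCut]

theorem integrable_cut (h : IsDyadicProfile φ) (j : ℤ) : Integrable (dyadicCut φ j) := by
  refine (h.continuous_cut j).integrable_of_hasCompactSupport ?_
  refine HasCompactSupport.of_support_subset_isCompact
    (isCompact_closedBall (0 : Rd d) (8/3 * 2 ^ j)) fun x hx => ?_
  simpa using (h.norm_mem hx).2

theorem integrable_kernel_zero (h : IsDyadicProfile φ) : Integrable (dyadicKernel φ 0) := by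
  have hs : ContDiff ℝ (⊤ : ℕ∞) (dyadicCut φ 0) := by
    have := h.smooth
    unfold dyadicCut
    exact Complex.ofRealCLM.contDiff.comp (this.comp (contDiff_const_smul _))
  have hc : HasCompactSupport (dyadicCut φ 0) :=
    HasCompactSupport.of_support_subset_isCompact
      (isCompact_closedBall (0 : Rd d) (8/3 * 2 ^ (0:ℤ))) fun x hx => by
        simpa using (h.norm_mem hx).2
  have e : dyadicKernel φ 0 = ⇑(𝓕⁻ (hc.toSchwartzMap hs) : 𝓢(Rd d, ℂ)) := by
    rw [SchwartzMap.fourierInv_coe]; rfl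
  rw [e]
  exact SchwartzMap.integrable _

theorem integrable_kernel (h : IsDyadicProfile φ) (j : ℤ) : Integrable (dyadicKernel φ j) := by
  have e : dyadicKernel φ j = fun x => (((2:ℝ) ^ j) ^ d : ℝ) * dyadicKernel φ 0 ((2:ℝ) ^ j • x) :=
    funext fun x => kernel_scaling j x
  rw [e]
  exact (h.integrable_kernel_zero.comp_smul (by positivity : (2:ℝ) ^ j ≠ 0)).const_mul _

theorem lintegral_kernel (h : IsDyadicProfile φ) (j : ℤ) :
    ∫⁻ x, ‖dyadicKernel φ j x‖ₑ = ∫⁻ x, ‖dyadicKernel φ 0 x‖ₑ := by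
  rw [← ofReal_integral_norm_eq_lintegral_enorm (h.integrable_kernel j),
    ← ofReal_integral_norm_eq_lintegral_enorm h.integrable_kernel_zero]
  congr 1
  simp_rw [kernel_scaling (φ := φ) j, norm_mul, Complex.norm_real]
  rw [integral_const_mul, Measure.integral_comp_smul (volume : Measure (Rd d))
    (fun x => ‖dyadicKernel φ 0 x‖) ((2:ℝ) ^ j), finrank_euclideanSpace_fin, smul_eq_mul,
    ← mul_assoc, Real.norm_of_nonneg (by positivity), abs_of_nonneg (by positivity),
    mul_inv_cancel₀ (by positivity), one_mul]

theorem enorm_kernel_le (j : ℤ) (x : Rd d) :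
    ‖dyadicKernel φ j x‖ₑ ≤ ENNReal.ofReal (∫ ξ, ‖dyadicCut φ 0 ξ‖) * (2:ℝ≥0∞) ^ ((j:ℝ) * d) := by
  rw [kernel_scaling, enorm_mul, mul_comm]
  gcongr
  · rw [← ofReal_norm]
    exact ENNReal.ofReal_le_ofReal (norm_fourierInv_le _ _)
  · rw [← ofReal_norm, Complex.norm_real, Real.norm_of_nonneg (by positivity), ← Real.rpow_intCast,
      ← Real.rpow_natCast, ← Real.rpow_mul (by norm_num),
      ← ENNReal.ofReal_rpow_of_pos (by norm_num)]
    simp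

theorem fourier_kernel (h : IsDyadicProfile φ) (j : ℤ) : 𝓕 (dyadicKernel φ j) = dyadicCut φ j := by
  refine (h.continuous_cut j).fourier_fourierInv_eq (h.integrable_cut j)
    ((h.integrable_kernel j).comp_neg.congr (Filter.Eventually.of_forall fun x => ?_))
  simp only
  rw [dyadicKernel, fourierInv_eq_fourier_neg, neg_neg]

end IsDyadicProfile

theorem integral_mul_fourierInv_sub {d : ℕ} {K : Rd d → ℂ} (hK : Integrable K)
    {U : Rd d → ℂ} (hU : Integrable U) (x : Rd d) :
    ∫ y, K y * 𝓕⁻ U (x - y) = 𝓕⁻ (fun ξ => 𝓕 K ξ * U ξ) x := by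
  have hInteg : Integrable (Function.uncurry fun (y ξ : Rd d) =>
      K y * ((𝐞 (inner ℝ ξ (x - y)) : ℂ) * U ξ)) (volume.prod volume) := by
    have h1 := hK.mul_prod hU
    refine h1.mono ?_ (Filter.Eventually.of_forall fun z => ?_)
    · have hc : Continuous fun z : Rd d × Rd d => (𝐞 (inner ℝ z.2 (x - z.1)) : ℂ) := by
        refine continuous_subtype_val.comp (Real.continuous_fourierChar.comp ?_)
        fun_prop
      have := hc.aestronglyMeasurable.mul h1.1
      refine this.congr (Filter.Eventually.of_forall fun z => ?_)
      simp only [Function.uncurry, Pi.mul_apply]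
      ring
    · simp [Function.uncurry, Circle.norm_coe]
  calc ∫ y, K y * 𝓕⁻ U (x - y)
      = ∫ y, ∫ ξ, K y * ((𝐞 (inner ℝ ξ (x - y)) : ℂ) * U ξ) := by
        congr with t
        rw [Real.fourierInv_eq, ← integral_const_mul]
        rfl
    _ = ∫ ξ, ∫ y, K y * ((𝐞 (inner ℝ ξ (x - y)) : ℂ) * U ξ) := integral_integral_swap hInteg
    _ = _ := by
        rw [Real.fourierInv_eq]
        congr with ξ
        rw [Real.fourier_eq, ← integral_mul_const, Circle.smul_def, smul_eq_mul,
          ← integral_const_mul]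
        congr with y
        rw [inner_sub_right, sub_eq_add_neg, AddChar.map_add_eq_mul, Circle.smul_def, smul_eq_mul,
          real_inner_comm ξ y]
        simp
        ring

/-- The Littlewood–Paley piece `𝓕⁻ (φ(2^{-k} ξ) U(ξ))` of the function with Fourier transform `U`. -/
def dyadicPiece {d : ℕ} (φ : Rd d → ℝ) (k : ℤ) (U : Rd d → ℂ) : Rd d → ℂ :=
  𝓕⁻ fun ξ => dyadicCut φ k ξ * U ξ

theorem fourierInv_finsetSum {d : ℕ} {ι : Type*} (s : Finset ι) {F : ι → Rd d → ℂ}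
    (hF : ∀ i ∈ s, Integrable (F i)) (x : Rd d) :
    𝓕⁻ (fun ξ => ∑ i ∈ s, F i ξ) x = ∑ i ∈ s, 𝓕⁻ (F i) x := by
  simp only [Real.fourierInv_eq, Finset.smul_sum]
  refine integral_finsetSum _ fun i hi => ?_
  exact ((Real.fourierIntegral_convergent_iff (-x)).2 (hF i hi)).congr (by simp)

theorem norm_fourierInv_le_of_norm_le {d : ℕ} {U W : Rd d → ℂ} (hU : Integrable U) {M : ℝ}
    (hW : ∀ ξ, ‖W ξ‖ ≤ M * ‖U ξ‖) (x : Rd d) : ‖𝓕⁻ W x‖ ≤ M * ∫ ξ, ‖U ξ‖ := by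
  refine (norm_fourierInv_le W x).trans ?_
  rw [← integral_const_mul]
  exact integral_mono_of_nonneg (Filter.Eventually.of_forall fun _ => norm_nonneg _)
    (hU.norm.const_mul M) (Filter.Eventually.of_forall hW)

namespace IsDyadicProfile

variable {d : ℕ} {φ : Rd d → ℝ}

theorem dyadicPiece_eq_integral (h : IsDyadicProfile φ) (j : ℤ) {H : Rd d → ℂ} (hH : Integrable H)
    (x : Rd d) : dyadicPiece φ j H x = ∫ y, dyadicKernel φ j y * 𝓕⁻ H (x - y) := by
  rw [integral_mul_fourierInv_sub (h.integrable_kernel j) hH, h.fourier_kernel]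
  rfl

theorem continuous_dyadicPiece (h : IsDyadicProfile φ) (j : ℤ) {U : Rd d → ℂ}
    (hU : Integrable U) : Continuous (dyadicPiece φ j U) :=
  continuous_fourierInv (h.integrable_cut_mul j hU)

theorem integrable_trunc (h : IsDyadicProfile φ) (s : Finset ℤ) {U : Rd d → ℂ}
    (hU : Integrable U) : Integrable fun ξ => ∑ k ∈ s, dyadicCut φ k ξ * U ξ :=
  integrable_finsetSum _ fun k _ => h.integrable_cut_mul k hU

theorem norm_trunc_le (h : IsDyadicProfile φ) {M : ℝ} (hM : ∀ x, |φ x| ≤ M) (s : Finset ℤ)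
    {U : Rd d → ℂ} (ξ : Rd d) : ‖∑ k ∈ s, dyadicCut φ k ξ * U ξ‖ ≤ 3 * M * ‖U ξ‖ := by
  rw [← Finset.sum_mul, norm_mul]
  gcongr
  exact h.norm_sum_cut_le hM s ξ

theorem tendsto_fourierInv_trunc [NeZero d] (h : IsDyadicProfile φ) {U : Rd d → ℂ}
    (hU : Integrable U) (x : Rd d) :
    Filter.Tendsto (fun n : ℕ => 𝓕⁻ (fun ξ => ∑ k ∈ Finset.Icc (-(n:ℤ)) n,
      dyadicCut φ k ξ * U ξ) x) Filter.atTop (nhds (𝓕⁻ U x)) := by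
  obtain ⟨M, hM⟩ := h.exists_bound
  simp only [Real.fourierInv_eq]
  have : Nontrivial (Rd d) := inferInstance
  refine tendsto_integral_of_dominated_convergence (fun ξ => 3 * M * ‖U ξ‖) (fun n => ?_)
    (hU.norm.const_mul _) (fun n => Filter.Eventually.of_forall fun ξ => ?_) ?_
  · exact ((Real.fourierIntegral_convergent_iff (-x)).2
      (h.integrable_trunc (Finset.Icc (-(n:ℤ)) n) hU)).1.congr (by simp)
  · rw [Circle.norm_smul]
    exact h.norm_trunc_le hM _ ξ
  · filter_upwards [compl_mem_ae_iff.2 (measure_singleton (0 : Rd d))] with ξ hξ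
    refine tendsto_const_nhds.congr' ?_
    filter_upwards [h.tendsto_sum_cut hξ] with n hn
    rw [← Finset.sum_mul, hn, one_mul]

theorem dyadicPiece_freqConv (h : IsDyadicProfile φ) (j : ℤ) {U V : Rd d → ℂ} (hU : Integrable U)
    (hV : Integrable V) (x : Rd d) : dyadicPiece φ j (freqConv U V) x =
      ∫ y, dyadicKernel φ j y * (𝓕⁻ U (x - y) * 𝓕⁻ V (x - y)) := by
  rw [h.dyadicPiece_eq_integral j (integrable_freqConv hU hV)]
  simp_rw [fourierInv_freqConv hU hV]

theorem integrable_kernel_mul (h : IsDyadicProfile φ) (j : ℤ) {U V : Rd d → ℂ} (hU : Integrable U)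
    (hV : Integrable V) (x : Rd d) :
    Integrable fun y => dyadicKernel φ j y * (𝓕⁻ U (x - y) * 𝓕⁻ V (x - y)) := by
  have cU := continuous_fourierInv hU
  have cV := continuous_fourierInv hV
  refine (h.integrable_kernel j).mul_bdd (c := (∫ ξ, ‖U ξ‖) * ∫ ξ, ‖V ξ‖)
    (by fun_prop) (Filter.Eventually.of_forall fun y => ?_)
  rw [norm_mul]
  gcongr <;> exact norm_fourierInv_le _ _

theorem dyadicPiece_freqConv_trunc (h : IsDyadicProfile φ) (j : ℤ) (s : Finset ℤ) {U V : Rd d → ℂ}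
    (hU : Integrable U) (hV : Integrable V) (x : Rd d) :
    dyadicPiece φ j (freqConv (fun ξ => ∑ k ∈ s, dyadicCut φ k ξ * U ξ)
      (fun ξ => ∑ l ∈ s, dyadicCut φ l ξ * V ξ)) x =
    ∑ k ∈ s, ∑ l ∈ s, dyadicPiece φ j (freqConv (fun ξ => dyadicCut φ k ξ * U ξ)
      (fun ξ => dyadicCut φ l ξ * V ξ)) x := by
  have iU := fun k => h.integrable_cut_mul k hU
  have iV := fun k => h.integrable_cut_mul k hV
  rw [h.dyadicPiece_freqConv j (h.integrable_trunc s hU) (h.integrable_trunc s hV)]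
  simp_rw [fun k l => h.dyadicPiece_freqConv j (iU k) (iV l) x,
    fourierInv_finsetSum s fun k _ => iU k, fourierInv_finsetSum s fun k _ => iV k,
    Finset.sum_mul_sum, Finset.mul_sum]
  rw [integral_finsetSum _ fun k _ => integrable_finsetSum _ fun l _ =>
    h.integrable_kernel_mul j (iU k) (iV l) x]
  exact Finset.sum_congr rfl fun k _ => integral_finsetSum _ fun l _ =>
    h.integrable_kernel_mul j (iU k) (iV l) x

theorem tendsto_dyadicPiece_freqConv_trunc [NeZero d] (h : IsDyadicProfile φ) (j : ℤ)
    {U V : Rd d → ℂ} (hU : Integrable U) (hV : Integrable V) (x : Rd d) :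
    Filter.Tendsto (fun n : ℕ => dyadicPiece φ j
      (freqConv (fun ξ => ∑ k ∈ Finset.Icc (-(n:ℤ)) n, dyadicCut φ k ξ * U ξ)
        (fun ξ => ∑ l ∈ Finset.Icc (-(n:ℤ)) n, dyadicCut φ l ξ * V ξ)) x) Filter.atTop
      (nhds (dyadicPiece φ j (freqConv U V) x)) := by
  obtain ⟨M, hM⟩ := h.exists_bound
  have iU := fun n : ℕ => h.integrable_trunc (Finset.Icc (-(n:ℤ)) n) hU
  have iV := fun n : ℕ => h.integrable_trunc (Finset.Icc (-(n:ℤ)) n) hV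
  rw [h.dyadicPiece_freqConv j hU hV]
  simp_rw [fun n : ℕ => h.dyadicPiece_freqConv j (iU n) (iV n) x]
  refine tendsto_integral_of_dominated_convergence
    (fun y => ‖dyadicKernel φ j y‖ * ((3 * M * ∫ ξ, ‖U ξ‖) * (3 * M * ∫ ξ, ‖V ξ‖)))
    (fun n => (h.integrable_kernel_mul j (iU n) (iV n) x).1)
    ((h.integrable_kernel j).norm.mul_const _)
    (fun n => Filter.Eventually.of_forall fun y => ?_)
    (Filter.Eventually.of_forall fun y => ?_)
  · rw [norm_mul, norm_mul]
    have a1 := norm_fourierInv_le_of_norm_le hU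
      (h.norm_trunc_le (U := U) hM (Finset.Icc (-(n:ℤ)) n)) (x - y)
    have a2 := norm_fourierInv_le_of_norm_le hV
      (h.norm_trunc_le (U := V) hM (Finset.Icc (-(n:ℤ)) n)) (x - y)
    gcongr
    exact (norm_nonneg _).trans a1
  · exact ((h.tendsto_fourierInv_trunc hU _).mul (h.tendsto_fourierInv_trunc hV _)).const_mul _

theorem eLpNorm_dyadicPiece_freqConv_le [NeZero d] (h : IsDyadicProfile φ) {p : ℝ≥0∞} (hp : 1 ≤ p)
    (j : ℤ) {U V : Rd d → ℂ} (hU : Integrable U) (hV : Integrable V) :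
    eLpNorm (dyadicPiece φ j (freqConv U V)) p volume ≤
      ∑' k, ∑' l, eLpNorm (dyadicPiece φ j (freqConv (fun ξ => dyadicCut φ k ξ * U ξ)
        (fun ξ => dyadicCut φ l ξ * V ξ))) p volume := by
  have iU := fun k => h.integrable_cut_mul k hU
  have iV := fun k => h.integrable_cut_mul k hV
  have mP := fun k l => (h.continuous_dyadicPiece j
    (integrable_freqConv (iU k) (iV l))).aestronglyMeasurable (μ := volume)
  have e : ∀ n : ℕ, dyadicPiece φ j
      (freqConv (fun ξ => ∑ k ∈ Finset.Icc (-(n:ℤ)) n, dyadicCut φ k ξ * U ξ)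
        (fun ξ => ∑ l ∈ Finset.Icc (-(n:ℤ)) n, dyadicCut φ l ξ * V ξ)) =
      ∑ k ∈ Finset.Icc (-(n:ℤ)) n, ∑ l ∈ Finset.Icc (-(n:ℤ)) n,
        dyadicPiece φ j (freqConv (fun ξ => dyadicCut φ k ξ * U ξ)
          (fun ξ => dyadicCut φ l ξ * V ξ)) := fun n => by
    ext x
    simp only [h.dyadicPiece_freqConv_trunc j _ hU hV x, Finset.sum_apply]
  refine (Lp.eLpNorm_lim_le_liminf_eLpNorm (fun n : ℕ => ?_) _ (Filter.Eventually.of_forall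
    fun x => h.tendsto_dyadicPiece_freqConv_trunc j hU hV x)).trans ?_
  · exact (h.continuous_dyadicPiece j (integrable_freqConv (h.integrable_trunc _ hU)
      (h.integrable_trunc _ hV))).aestronglyMeasurable
  refine Filter.liminf_le_of_frequently_le' (Filter.Frequently.of_forall fun n => ?_)
  rw [e]
  refine (eLpNorm_sum_le (fun k _ => Finset.aestronglyMeasurable_sum _ fun l _ => mP k l) hp).trans
    (le_trans ?_ (ENNReal.sum_le_tsum (Finset.Icc (-(n:ℤ)) n)))
  gcongr with k
  exact (eLpNorm_sum_le (fun l _ => mP k l) hp).trans (ENNReal.sum_le_tsum _)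

end IsDyadicProfile

namespace IsDyadicProfile

variable {d : ℕ} {φ : Rd d → ℝ}

theorem enorm_dyadicPiece_le (h : IsDyadicProfile φ) (j : ℤ) {H : Rd d → ℂ} (hH : Integrable H)
    (x : Rd d) :
    ‖dyadicPiece φ j H x‖ₑ ≤ ∫⁻ y, ‖dyadicKernel φ j y‖ₑ * ‖𝓕⁻ H (x - y)‖ₑ := by
  rw [h.dyadicPiece_eq_integral j hH]
  refine (enorm_integral_le_lintegral_enorm _).trans_eq ?_
  simp_rw [enorm_mul]

theorem measurable_kernel (h : IsDyadicProfile φ) (j : ℤ) :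
    Measurable fun y => ‖dyadicKernel φ j y‖ₑ :=
  (continuous_fourierInv (h.integrable_cut j)).measurable.enorm

theorem lintegral_kernel_zero_ne_top (h : IsDyadicProfile φ) :
    ∫⁻ x, ‖dyadicKernel φ 0 x‖ₑ ≠ ∞ := h.integrable_kernel_zero.2.ne

/-- Bernstein's inequality from `L^q` to `L^P` with `P` finite. -/
theorem exists_eLpNorm_dyadicPiece_le (h : IsDyadicProfile φ) {q P : ℝ} (hq : 1 ≤ q) (hqP : q ≤ P) :
    ∃ C : ℝ≥0, ∀ (j : ℤ) (H : Rd d → ℂ), Integrable H →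
      eLpNorm (dyadicPiece φ j H) (ENNReal.ofReal P) volume ≤
        C * (2:ℝ≥0∞) ^ ((j:ℝ) * (d * (1 / q - 1 / P))) *
          eLpNorm (𝓕⁻ H) (ENNReal.ofReal q) volume := by
  have hq0 : 0 < q := by linarith
  have hP0 : 0 < P := by linarith
  have hP1 : 1 ≤ P / q := by rw [le_div_iff₀ hq0]; linarith
  set a := ∫⁻ x, ‖dyadicKernel φ 0 x‖ₑ
  set β := ENNReal.ofReal (∫ ξ, ‖dyadicCut φ 0 ξ‖)
  have ha : a ≠ ∞ := h.lintegral_kernel_zero_ne_top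
  have hβ : β ≠ ∞ := ENNReal.ofReal_ne_top
  have hC : (a ^ ((q - 1) * (P / q) + 1)) ^ (1 / P) * (β ^ (P / q - 1)) ^ (1 / P) ≠ ∞ := by
    refine ENNReal.mul_ne_top ?_ ?_
    · refine ENNReal.rpow_ne_top_of_nonneg (by positivity)
        (ENNReal.rpow_ne_top_of_nonneg ?_ ha)
      have : 0 ≤ (q - 1) * (P / q) := mul_nonneg (by linarith) (by linarith)
      linarith
    · exact ENNReal.rpow_ne_top_of_nonneg (by positivity)
        (ENNReal.rpow_ne_top_of_nonneg (by linarith) hβ)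
  refine ⟨((a ^ ((q - 1) * (P / q) + 1)) ^ (1 / P) * (β ^ (P / q - 1)) ^ (1 / P)).toNNReal,
    fun j H hH => ?_⟩
  rw [ENNReal.coe_toNNReal hC, eLpNorm_ofReal_eq hP0, eLpNorm_ofReal_eq hq0]
  have hle : ∫⁻ x, ‖dyadicPiece φ j H x‖ₑ ^ P ≤ a ^ ((q - 1) * (P / q) + 1) *
      (β * (2:ℝ≥0∞) ^ ((j:ℝ) * d)) ^ (P / q - 1) * (∫⁻ x, ‖𝓕⁻ H x‖ₑ ^ q) ^ (P / q) :=
    (lintegral_mono fun x => ENNReal.rpow_le_rpow (h.enorm_dyadicPiece_le j hH x) hP0.le).trans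
      (lintegral_conv_rpow_le volume (h.measurable_kernel j)
        (continuous_fourierInv hH).measurable.enorm
        (h.lintegral_kernel j).le (enorm_kernel_le j) hq hqP)
  refine (ENNReal.rpow_le_rpow hle (by positivity)).trans_eq ?_
  have e1 : (j:ℝ) * d * (P / q - 1) * (1 / P) = j * (d * (1 / q - 1 / P)) := by
    field_simp
  have e2 : P / q * (1 / P) = 1 / q := by field_simp
  rw [ENNReal.mul_rpow_of_nonneg _ _ (by positivity), ENNReal.mul_rpow_of_nonneg _ _ (by positivity),
    ENNReal.mul_rpow_of_nonneg _ _ (by linarith), ENNReal.mul_rpow_of_nonneg _ _ (by positivity),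
    ← ENNReal.rpow_mul (∫⁻ x, ‖𝓕⁻ H x‖ₑ ^ q), ← ENNReal.rpow_mul 2, ← ENNReal.rpow_mul 2, e1, e2]
  ring

/-- Bernstein's inequality from `L^q` to `L^∞`. -/
theorem exists_eLpNorm_top_dyadicPiece_le (h : IsDyadicProfile φ) {q : ℝ} (hq : 1 ≤ q) :
    ∃ C : ℝ≥0, ∀ (j : ℤ) (H : Rd d → ℂ), Integrable H →
      eLpNorm (dyadicPiece φ j H) ∞ volume ≤
        C * (2:ℝ≥0∞) ^ ((j:ℝ) * (d / q)) * eLpNorm (𝓕⁻ H) (ENNReal.ofReal q) volume := by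
  have hq0 : 0 < q := by linarith
  set a := ∫⁻ x, ‖dyadicKernel φ 0 x‖ₑ
  set β := ENNReal.ofReal (∫ ξ, ‖dyadicCut φ 0 ξ‖)
  have ha : a ≠ ∞ := h.lintegral_kernel_zero_ne_top
  have hβ : β ≠ ∞ := ENNReal.ofReal_ne_top
  have hC : (a ^ (q - 1)) ^ (1 / q) * β ^ (1 / q) ≠ ∞ :=
    ENNReal.mul_ne_top (ENNReal.rpow_ne_top_of_nonneg (by positivity)
      (ENNReal.rpow_ne_top_of_nonneg (by linarith) ha))
      (ENNReal.rpow_ne_top_of_nonneg (by positivity) hβ)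
  refine ⟨((a ^ (q - 1)) ^ (1 / q) * β ^ (1 / q)).toNNReal, fun j H hH => ?_⟩
  rw [ENNReal.coe_toNNReal hC, eLpNorm_ofReal_eq hq0, eLpNorm_exponent_top]
  refine eLpNormEssSup_le_of_ae_enorm_bound (Filter.Eventually.of_forall fun x => ?_)
  have hle := lintegral_conv_rpow_le_sup volume (h.measurable_kernel j)
        (continuous_fourierInv hH).measurable.enorm
        (h.lintegral_kernel j).le (enorm_kernel_le j) hq x
  refine (h.enorm_dyadicPiece_le j hH x).trans ?_
  have h2 := ENNReal.rpow_le_rpow hle (by positivity : 0 ≤ 1 / q)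
  rw [← ENNReal.rpow_mul, mul_one_div_cancel hq0.ne', ENNReal.rpow_one] at h2
  refine h2.trans_eq ?_
  have e1 : (j:ℝ) * d * (1 / q) = j * (d / q) := by ring
  rw [ENNReal.mul_rpow_of_nonneg _ _ (by positivity), ENNReal.mul_rpow_of_nonneg _ _ (by positivity),
    ENNReal.mul_rpow_of_nonneg _ _ (by positivity), ← ENNReal.rpow_mul 2, e1]
  ring

/-- A bound for all blocks passes to frequency-localized functions. -/
theorem eLpNorm_dyadicPiece_le_of_forall (h : IsDyadicProfile φ) {q P : ℝ≥0∞} (hP : 1 ≤ P) {D : ℝ}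
    (hD : 0 ≤ D) {C : ℝ≥0} (hC : ∀ (j : ℤ) (H : Rd d → ℂ), Integrable H →
      eLpNorm (dyadicPiece φ j H) P volume ≤
        C * (2:ℝ≥0∞) ^ ((j:ℝ) * D) * eLpNorm (𝓕⁻ H) q volume)
    (k : ℤ) {U : Rd d → ℂ} (hU : Integrable U) :
    eLpNorm (dyadicPiece φ k U) P volume ≤
      3 * C * (2:ℝ≥0∞) ^ D * (2:ℝ≥0∞) ^ ((k:ℝ) * D) * eLpNorm (dyadicPiece φ k U) q volume := by
  have iU := h.integrable_cut_mul k hU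
  have e : dyadicPiece φ k U = 𝓕⁻ fun ξ => ∑ l ∈ Finset.Icc (k - 1) (k + 1),
      dyadicCut φ l ξ * (dyadicCut φ k ξ * U ξ) := by
    rw [dyadicPiece]
    congr 1 with ξ
    rw [← Finset.sum_mul]
    by_cases hk : dyadicCut φ k ξ = 0
    · simp [hk]
    · rw [h.sum_cut_near hk subset_rfl, one_mul]
  calc eLpNorm (dyadicPiece φ k U) P volume
      ≤ ∑ l ∈ Finset.Icc (k - 1) (k + 1),
          eLpNorm (dyadicPiece φ l fun ξ => dyadicCut φ k ξ * U ξ) P volume := by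
        rw [e]
        exact eLpNorm_fourierInv_sum_le hP _ fun l _ => h.integrable_cut_mul l iU
    _ ≤ ∑ l ∈ Finset.Icc (k - 1) (k + 1), C * ((2:ℝ≥0∞) ^ D * (2:ℝ≥0∞) ^ ((k:ℝ) * D)) *
          eLpNorm (dyadicPiece φ k U) q volume := by
        refine Finset.sum_le_sum fun l hl => (hC l _ iU).trans ?_
        rw [← ENNReal.rpow_add _ _ (by norm_num) (by norm_num)]
        gcongr
        · norm_num
        · have : (l:ℝ) ≤ k + 1 := by exact_mod_cast (Finset.mem_Icc.1 hl).2
          nlinarith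
        · rfl
    _ = _ := by
        rw [Finset.sum_const, Int.card_Icc, show (k + 1 + 1 - (k - 1)).toNat = 3 by lia]
        simp only [nsmul_eq_mul, Nat.cast_ofNat]
        ring

/-- The support of the convolution of two dyadic frequency pieces. -/
theorem exists_of_cut_mul_freqConv_ne_zero {j k l : ℤ} {U V : Rd d → ℂ} {ζ : Rd d}
    (hne : dyadicCut φ j ζ * freqConv (fun ξ => dyadicCut φ k ξ * U ξ)
      (fun ξ => dyadicCut φ l ξ * V ξ) ζ ≠ 0) :
    dyadicCut φ j ζ ≠ 0 ∧ ∃ η, dyadicCut φ k η ≠ 0 ∧ dyadicCut φ l (ζ - η) ≠ 0 := by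
  refine ⟨left_ne_zero_of_mul hne, ?_⟩
  by_contra! hη
  refine right_ne_zero_of_mul hne ?_
  rw [freqConv]
  refine integral_eq_zero_of_ae (Filter.Eventually.of_forall fun η => ?_)
  by_cases hk : dyadicCut φ k η = 0
  · simp [hk]
  · simp [hη η hk]

/-- If the block `j` of the product of the pieces `k` and `l` does not vanish, the two largest
frequencies are comparable. -/
theorem eLpNorm_dyadicPiece_freqConv_eq_zero (h : IsDyadicProfile φ) (p : ℝ≥0∞) {j k l : ℤ}
    (U V : Rd d → ℂ) (hjkl : ¬ (j ≤ max k l + 2 ∧ k ≤ max j l + 2 ∧ l ≤ max j k + 2)) :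
    eLpNorm (dyadicPiece φ j (freqConv (fun ξ => dyadicCut φ k ξ * U ξ)
      (fun ξ => dyadicCut φ l ξ * V ξ))) p volume = 0 := by
  have hz : (fun ζ => dyadicCut φ j ζ * freqConv (fun ξ => dyadicCut φ k ξ * U ξ)
      (fun ξ => dyadicCut φ l ξ * V ξ) ζ) = 0 := by
    funext ζ
    by_contra hne
    obtain ⟨hj, η, hk, hl⟩ := exists_of_cut_mul_freqConv_ne_zero hne
    obtain ⟨j1, j2⟩ := h.norm_mem hj
    obtain ⟨k1, k2⟩ := h.norm_mem hk
    obtain ⟨l1, l2⟩ := h.norm_mem hl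
    have key : ∀ a b c : ℤ, 3/4 * (2:ℝ) ^ a ≤ 8/3 * 2 ^ b + 8/3 * 2 ^ c → a ≤ max b c + 2 := by
      intro a b c habc
      by_contra! hlt
      have hb : (2:ℝ) ^ b ≤ 2 ^ (max b c) := zpow_le_zpow_right₀ (by norm_num) (le_max_left _ _)
      have hc : (2:ℝ) ^ c ≤ 2 ^ (max b c) := zpow_le_zpow_right₀ (by norm_num) (le_max_right _ _)
      have ha : (2:ℝ) ^ (max b c + 3) ≤ 2 ^ a := zpow_le_zpow_right₀ (by norm_num) (by lia)
      rw [zpow_add₀ (by norm_num)] at ha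
      have h0 : (0:ℝ) < 2 ^ (max b c) := by positivity
      norm_num at ha
      linarith
    have t1 : ‖ζ‖ ≤ ‖η‖ + ‖ζ - η‖ := by simpa using norm_add_le η (ζ - η)
    have t2 : ‖η‖ ≤ ‖ζ‖ + ‖ζ - η‖ := by simpa using norm_sub_le ζ (ζ - η)
    have t3 : ‖ζ - η‖ ≤ ‖ζ‖ + ‖η‖ := norm_sub_le ζ η
    exact hjkl ⟨key _ _ _ (by linarith), key _ _ _ (by linarith), key _ _ _ (by linarith)⟩
  rw [dyadicPiece, hz, fourierInv_zero, eLpNorm_zero]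

end IsDyadicProfile

theorem freqConv_comm {d : ℕ} (U V : Rd d → ℂ) : freqConv U V = freqConv V U := by
  funext ζ
  rw [freqConv, freqConv, ← integral_sub_left_eq_self _ volume ζ]
  congr with η
  rw [sub_sub_cancel, mul_comm]

theorem eLpNorm_fourierInv_freqConv_le {d : ℕ} {U V : Rd d → ℂ} (hU : Integrable U)
    (hV : Integrable V) (a b r : ℝ≥0∞) [a.HolderTriple b r] :
    eLpNorm (𝓕⁻ (freqConv U V)) r volume ≤ eLpNorm (𝓕⁻ U) a volume * eLpNorm (𝓕⁻ V) b volume := by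
  have e : 𝓕⁻ (freqConv U V) = 𝓕⁻ U • 𝓕⁻ V := funext fun x => fourierInv_freqConv hU hV x
  rw [e]
  exact eLpNorm_smul_le_mul_eLpNorm (continuous_fourierInv hV).aestronglyMeasurable
    (continuous_fourierInv hU).aestronglyMeasurable

/-- The exponent `d max(0, 2/p - 1)` lost in high-high interactions. -/
def remainderLoss (d : ℕ) (p : ℝ) : ℝ := d * max 0 (2 / p - 1)

/-- The size of the contribution of the frequencies `k` and `l` to the block `j` of a product in
`L^p`. -/
def interactionWeight (d : ℕ) (p : ℝ) (j k l : ℤ) : ℝ≥0∞ :=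
  if k ≤ l - 3 then (if |j - l| ≤ 2 then (2:ℝ≥0∞) ^ ((k:ℝ) * (d / p)) else 0)
  else if l ≤ k - 3 then (if |j - k| ≤ 2 then (2:ℝ≥0∞) ^ ((l:ℝ) * (d / p)) else 0)
  else if j ≤ k + 4 then
    (2:ℝ≥0∞) ^ ((j:ℝ) * (d / p) + ((k:ℝ) - j) * remainderLoss d p) else 0

namespace IsDyadicProfile

variable {d : ℕ} {φ : Rd d → ℝ}

theorem eLpNorm_dyadicPiece_freqConv_le_of_bernstein (h : IsDyadicProfile φ) {P r a b : ℝ≥0∞}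
    [a.HolderTriple b r] {D₁ D₂ : ℝ} {C₁ C₂ : ℝ≥0∞} {j k l : ℤ} {U V : Rd d → ℂ}
    (hU : Integrable U) (hV : Integrable V)
    (h₁ : ∀ H : Rd d → ℂ, Integrable H → eLpNorm (dyadicPiece φ j H) P volume ≤
      C₁ * (2:ℝ≥0∞) ^ ((j:ℝ) * D₁) * eLpNorm (𝓕⁻ H) r volume)
    (h₂ : eLpNorm (dyadicPiece φ k U) a volume ≤
      C₂ * (2:ℝ≥0∞) ^ ((k:ℝ) * D₂) * eLpNorm (dyadicPiece φ k U) P volume) :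
    eLpNorm (dyadicPiece φ j (freqConv (fun ξ => dyadicCut φ k ξ * U ξ)
      (fun ξ => dyadicCut φ l ξ * V ξ))) P volume ≤
    C₁ * C₂ * (2:ℝ≥0∞) ^ ((j:ℝ) * D₁ + k * D₂) * eLpNorm (dyadicPiece φ k U) P volume *
      eLpNorm (dyadicPiece φ l V) b volume := by
  have iU := h.integrable_cut_mul k hU
  have iV := h.integrable_cut_mul l hV
  calc _ ≤ C₁ * (2:ℝ≥0∞) ^ ((j:ℝ) * D₁) *
        (eLpNorm (dyadicPiece φ k U) a volume * eLpNorm (dyadicPiece φ l V) b volume) := by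
        refine (h₁ _ (integrable_freqConv iU iV)).trans ?_
        gcongr
        exact eLpNorm_fourierInv_freqConv_le iU iV a b r
    _ ≤ C₁ * (2:ℝ≥0∞) ^ ((j:ℝ) * D₁) * ((C₂ * (2:ℝ≥0∞) ^ ((k:ℝ) * D₂) *
          eLpNorm (dyadicPiece φ k U) P volume) * eLpNorm (dyadicPiece φ l V) b volume) := by
        gcongr
    _ = _ := by
        rw [ENNReal.rpow_add _ _ (by norm_num) (by norm_num)]
        ring

/-- Low-high interactions. -/
theorem exists_lowHigh_bound (h : IsDyadicProfile φ) {p : ℝ} (hp : 1 < p) :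
    ∃ C : ℝ≥0, ∀ (j k l : ℤ) (U V : Rd d → ℂ), Integrable U → Integrable V →
      eLpNorm (dyadicPiece φ j (freqConv (fun ξ => dyadicCut φ k ξ * U ξ)
        (fun ξ => dyadicCut φ l ξ * V ξ))) (ENNReal.ofReal p) volume ≤
      C * (2:ℝ≥0∞) ^ ((k:ℝ) * (d / p)) * eLpNorm (dyadicPiece φ k U) (ENNReal.ofReal p) volume *
        eLpNorm (dyadicPiece φ l V) (ENNReal.ofReal p) volume := by
  obtain ⟨C₁, h₁⟩ := h.exists_eLpNorm_dyadicPiece_le hp.le le_rfl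
  obtain ⟨C₂, h₂⟩ := h.exists_eLpNorm_top_dyadicPiece_le hp.le
  have hfin : (3 * C₂ * (2:ℝ≥0∞) ^ ((d:ℝ) / p)) ≠ ∞ := by finiteness
  refine ⟨C₁ * (3 * C₂ * (2:ℝ≥0∞) ^ ((d:ℝ) / p)).toNNReal, fun j k l U V hU hV => ?_⟩
  have := h.eLpNorm_dyadicPiece_freqConv_le_of_bernstein (j := j) (k := k) (l := l)
    (a := ∞) (b := ENNReal.ofReal p) hU hV (h₁ j)
    (h.eLpNorm_dyadicPiece_le_of_forall le_top (by positivity) h₂ k hU)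
  rw [ENNReal.coe_mul, ENNReal.coe_toNNReal hfin]
  convert this using 5
  ring

/-- High-high interactions. -/
theorem exists_highHigh_bound (h : IsDyadicProfile φ) {p : ℝ} (hp : 1 < p) :
    ∃ C : ℝ≥0, ∀ (j k l : ℤ) (U V : Rd d → ℂ), Integrable U → Integrable V →
      eLpNorm (dyadicPiece φ j (freqConv (fun ξ => dyadicCut φ k ξ * U ξ)
        (fun ξ => dyadicCut φ l ξ * V ξ))) (ENNReal.ofReal p) volume ≤
      C * (2:ℝ≥0∞) ^ ((j:ℝ) * (d / p) + ((k:ℝ) - j) * remainderLoss d p) *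
        eLpNorm (dyadicPiece φ k U) (ENNReal.ofReal p) volume *
        eLpNorm (dyadicPiece φ l V) (ENNReal.ofReal p) volume := by
  have hp0 : 0 < p := by linarith
  rcases le_or_gt 2 p with h2 | h2
  · have hloss : remainderLoss d p = 0 := by
      rw [remainderLoss, max_eq_left, mul_zero]
      rw [sub_nonpos, div_le_one hp0]
      exact h2
    obtain ⟨C₁, h₁⟩ := h.exists_eLpNorm_dyadicPiece_le (q := p / 2) (P := p) (by linarith)
      (by linarith)
    have : (ENNReal.ofReal p).HolderTriple (ENNReal.ofReal p) (ENNReal.ofReal (p / 2)) := by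
      constructor
      rw [← ENNReal.ofReal_inv_of_pos hp0, ← ENNReal.ofReal_inv_of_pos (by positivity),
        ← ENNReal.ofReal_add (by positivity) (by positivity)]
      congr 1
      field_simp
      norm_num
    refine ⟨C₁, fun j k l U V hU hV => ?_⟩
    have := h.eLpNorm_dyadicPiece_freqConv_le_of_bernstein (j := j) (k := k) (l := l)
      (a := ENNReal.ofReal p) (b := ENNReal.ofReal p) (C₂ := 1) (D₂ := 0) hU hV (h₁ j) (by simp)
    rw [hloss]
    convert this using 4
    · rw [mul_one]
    · congr 1
      field_simp
      ring
  · have hloss : remainderLoss d p = d * (2 / p - 1) := by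
      rw [remainderLoss, max_eq_right]
      rw [sub_nonneg, le_div_iff₀ hp0]
      linarith
    have hc := Real.HolderConjugate.conjExponent hp
    set q := p.conjExponent
    have hq0 : 0 < q := hc.symm.pos
    have hinv : q⁻¹ = 1 - p⁻¹ := by linarith [hc.inv_add_inv_eq_one]
    have hpq : p ≤ q := by
      rw [← inv_le_inv₀ hq0 hp0, hinv]
      have : (2:ℝ)⁻¹ ≤ p⁻¹ := (inv_le_inv₀ (by norm_num) hp0).2 h2.le
      linarith
    obtain ⟨C₁, h₁⟩ := h.exists_eLpNorm_dyadicPiece_le (q := 1) (P := p) le_rfl hp.le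
    obtain ⟨C₂, h₂⟩ := h.exists_eLpNorm_dyadicPiece_le hp.le hpq
    have : (ENNReal.ofReal q).HolderTriple (ENNReal.ofReal p) (ENNReal.ofReal 1) := by
      constructor
      rw [← ENNReal.ofReal_inv_of_pos hp0, ← ENNReal.ofReal_inv_of_pos hq0,
        ← ENNReal.ofReal_add (by positivity) (by positivity), hinv]
      simp
    have hD : 0 ≤ (d:ℝ) * (1 / p - 1 / q) :=
      mul_nonneg (by positivity) (sub_nonneg.2 (one_div_le_one_div_of_le hp0 hpq))
    have hq1 : 1 ≤ ENNReal.ofReal q := by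
      rw [ENNReal.one_le_ofReal]; linarith
    have hfin : (3 * C₂ * (2:ℝ≥0∞) ^ ((d:ℝ) * (1 / p - 1 / q))) ≠ ∞ := by finiteness
    refine ⟨C₁ * (3 * C₂ * (2:ℝ≥0∞) ^ ((d:ℝ) * (1 / p - 1 / q))).toNNReal,
      fun j k l U V hU hV => ?_⟩
    have := h.eLpNorm_dyadicPiece_freqConv_le_of_bernstein (j := j) (k := k) (l := l)
      (a := ENNReal.ofReal q) (b := ENNReal.ofReal p) hU hV (h₁ j)
      (h.eLpNorm_dyadicPiece_le_of_forall hq1 hD h₂ k hU)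
    rw [ENNReal.coe_mul, ENNReal.coe_toNNReal hfin, hloss]
    convert this using 4
    congr 1
    rw [one_div q, hinv]
    ring

theorem exists_interaction_bound (h : IsDyadicProfile φ) {p : ℝ} (hp : 1 < p) :
    ∃ C : ℝ≥0, ∀ (j k l : ℤ) (U V : Rd d → ℂ), Integrable U → Integrable V →
      eLpNorm (dyadicPiece φ j (freqConv (fun ξ => dyadicCut φ k ξ * U ξ)
        (fun ξ => dyadicCut φ l ξ * V ξ))) (ENNReal.ofReal p) volume ≤
      C * interactionWeight d p j k l * eLpNorm (dyadicPiece φ k U) (ENNReal.ofReal p) volume *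
        eLpNorm (dyadicPiece φ l V) (ENNReal.ofReal p) volume := by
  obtain ⟨C₁, h₁⟩ := h.exists_lowHigh_bound hp
  obtain ⟨C₂, h₂⟩ := h.exists_highHigh_bound hp
  refine ⟨max C₁ C₂, fun j k l U V hU hV => ?_⟩
  by_cases hjkl : j ≤ max k l + 2 ∧ k ≤ max j l + 2 ∧ l ≤ max j k + 2
  swap
  · rw [h.eLpNorm_dyadicPiece_freqConv_eq_zero _ U V hjkl]
    exact zero_le
  rw [interactionWeight]
  split_ifs with h3 h4 h4 h5 h5
  · refine (h₁ j k l U V hU hV).trans ?_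
    gcongr
    exact le_max_left _ _
  · exact absurd (abs_le.2 ⟨by lia, by lia⟩) h4
  · rw [freqConv_comm]
    refine (h₁ j l k V U hV hU).trans ?_
    rw [mul_right_comm]
    gcongr
    exact le_max_left _ _
  · exact absurd (abs_le.2 ⟨by lia, by lia⟩) h5
  · refine (h₂ j k l U V hU hV).trans ?_
    gcongr
    exact le_max_right _ _
  · exact absurd (by lia) h5

end IsDyadicProfile

theorem IsDyadicProfile.exists_eLpNorm_LPblock_expL1_le {d : ℕ} [NeZero d] {φ : Rd d → ℝ}
    (h : IsDyadicProfile φ) {p : ℝ} (hp : 1 < p) :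
    ∃ K : ℝ≥0, ∀ τ : ℝ, 0 ≤ τ → ∀ (A B : 𝓢(Rd d, ℂ)) (j : ℤ),
      eLpNorm (LPblock d φ j (expL1 d τ (fun x => expL1 d (-τ) (⇑A) x * expL1 d (-τ) (⇑B) x)))
        (ENNReal.ofReal p) volume ≤
      ∑' k, ∑' l, K * interactionWeight d p j k l *
        eLpNorm (LPblock d φ k A) (ENNReal.ofReal p) volume *
        eLpNorm (LPblock d φ l B) (ENNReal.ofReal p) volume := by
  obtain ⟨M, hM⟩ := h.exists_bound
  obtain ⟨C, hcut, hweight⟩ := exists_isLpMultiplier_sign d hp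
  obtain ⟨C', hC'⟩ := h.exists_interaction_bound hp
  have hp1 : 1 ≤ ENNReal.ofReal p := by simpa using hp.le
  refine ⟨Fintype.card (Fin d → Bool) * (C ^ d * (C' * C ^ d * C ^ d)), fun τ hτ A B j => ?_⟩
  refine (eLpNorm_LPblock_expL1_le h.smooth.continuous hM hp hcut hτ (hweight τ hτ) A B j).trans ?_
  have hm : ∀ c : Fin d → Bool, IsLpMultiplier (ENNReal.ofReal p) (C ^ d)
      fun ξ => ∏ i, signWeight τ c i ξ := fun c => by
    simpa using IsLpMultiplier.prod Finset.univ fun i _ => hweight τ hτ c i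
  have hF : ∀ A : 𝓢(Rd d, ℂ), Integrable (𝓕 (⇑A)) := fun A => by
    rw [← SchwartzMap.fourier_coe]
    exact SchwartzMap.integrable _
  have hx : ∀ (c : Fin d → Bool) (k : ℤ) (A : 𝓢(Rd d, ℂ)),
      eLpNorm (dyadicPiece φ k fun ξ => (∏ i, signWeight τ c i ξ) * 𝓕 (⇑A) ξ)
        (ENNReal.ofReal p) volume ≤
      (C ^ d : ℝ≥0) * eLpNorm (LPblock d φ k A) (ENNReal.ofReal p) volume := fun c k A => by
    refine le_of_eq_of_le ?_ ((hm c).bound _ (h.integrable_cut_mul k (hF A)))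
    rw [dyadicPiece]
    congr 2 with ξ
    exact mul_left_comm _ _ _
  have hterm : ∀ c : Fin d → Bool, ((C ^ d : ℝ≥0) : ℝ≥0∞) *
      eLpNorm (𝓕⁻ fun ζ => (φ (((2:ℝ) ^ (-j)) • ζ) : ℂ) *
        freqConv (fun ξ => (∏ i, signWeight τ c i ξ) * 𝓕 (⇑A) ξ)
          (fun ξ => (∏ i, signWeight τ c i ξ) * 𝓕 (⇑B) ξ) ζ) (ENNReal.ofReal p) volume ≤
      ∑' k, ∑' l, (C ^ d * (C' * C ^ d * C ^ d) : ℝ≥0) * interactionWeight d p j k l *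
        eLpNorm (LPblock d φ k A) (ENNReal.ofReal p) volume *
        eLpNorm (LPblock d φ l B) (ENNReal.ofReal p) volume := fun c => by
    have iA := (hm c).integrable (hF A)
    have iB := (hm c).integrable (hF B)
    refine (mul_le_mul_right (h.eLpNorm_dyadicPiece_freqConv_le hp1 j iA iB) _).trans ?_
    simp_rw [← ENNReal.tsum_mul_left]
    refine ENNReal.tsum_le_tsum fun k => ENNReal.tsum_le_tsum fun l => ?_
    calc _ ≤ ((C ^ d : ℝ≥0) : ℝ≥0∞) * (C' * interactionWeight d p j k l *
          ((C ^ d : ℝ≥0) * eLpNorm (LPblock d φ k A) (ENNReal.ofReal p) volume) *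
          ((C ^ d : ℝ≥0) * eLpNorm (LPblock d φ l B) (ENNReal.ofReal p) volume)) := by
          refine mul_le_mul_right ((hC' j k l _ _ iA iB).trans ?_) _
          gcongr
          · exact hx c k A
          · exact hx c l B
      _ = _ := by
          push_cast
          ring
  refine (Finset.sum_le_sum fun c _ => hterm c).trans_eq ?_
  rw [Finset.sum_const, Finset.card_univ, nsmul_eq_mul]
  simp_rw [← ENNReal.tsum_mul_left]
  refine tsum_congr fun k => tsum_congr fun l => ?_
  push_cast
  ring

theorem tsum_int_rpow_ite_le_ne_top {δ : ℝ} (hδ : 0 < δ) (m : ℤ) :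
    ∑' n : ℤ, (if n ≤ m then (2:ℝ≥0∞) ^ ((n:ℝ) * δ) else 0) ≠ ∞ := by
  have hinj : Function.Injective fun i : ℕ => m - (i:ℤ) := fun a b hab => by
    have : m - (a:ℤ) = m - b := hab
    lia
  have hr : (2:ℝ≥0∞) ^ (-δ) < 1 := by
    rw [← ENNReal.rpow_zero (x := 2)]
    exact ENNReal.rpow_lt_rpow_of_exponent_lt (by norm_num) (by norm_num) (by linarith)
  rw [← hinj.tsum_eq fun n hn => ?_]
  · have e : ∀ i : ℕ, (if m - (i:ℤ) ≤ m then (2:ℝ≥0∞) ^ (((m - (i:ℤ) : ℤ):ℝ) * δ) else 0) =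
        (2:ℝ≥0∞) ^ ((m:ℝ) * δ) * ((2:ℝ≥0∞) ^ (-δ)) ^ i := fun i => by
      rw [if_pos (by lia), ← ENNReal.rpow_natCast, ← ENNReal.rpow_mul,
        ← ENNReal.rpow_add _ _ (by norm_num) (by norm_num)]
      push_cast
      ring_nf
    simp_rw [e]
    rw [ENNReal.tsum_mul_left, ENNReal.tsum_geometric]
    refine ENNReal.mul_ne_top (by finiteness) (ENNReal.inv_ne_top.2 ?_)
    exact (tsub_pos_of_lt hr).ne'
  · have hn' : n ≤ m := by
      by_contra hlt
      simp [hlt] at hn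
    exact ⟨(m - n).toNat, by simp only; lia⟩

theorem tsum_int_ite_abs_le_ne_top {c : ℝ≥0∞} (hc : c ≠ ∞) (m : ℤ) :
    ∑' n : ℤ, (if |n| ≤ m then c else 0) ≠ ∞ := by
  rw [tsum_eq_sum (s := Finset.Icc (-m) m)]
  · refine ENNReal.sum_ne_top.2 fun n _ => ?_
    split_ifs <;> simp [hc]
  · intro n hn
    rw [if_neg]
    rw [Finset.mem_Icc, ← abs_le] at hn
    exact hn

/-- The interaction weight normalized by the Besov weights of regularity `s₁`, `s₂` and
`s₁ + s₂ - d/p`. -/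
def besovWeight (d : ℕ) (p s₁ s₂ : ℝ) (j k l : ℤ) : ℝ≥0∞ :=
  (2:ℝ≥0∞) ^ ((j:ℝ) * (s₁ + s₂ - d / p) - k * s₁ - l * s₂) * interactionWeight d p j k l

theorem besovWeight_le {d : ℕ} {p s₁ s₂ : ℝ} (hs₁ : s₁ ≤ d / p) (j k l : ℤ) :
    besovWeight d p s₁ s₂ j k l ≤
      (if |j - l| ≤ 2 then (2:ℝ≥0∞) ^ (2 * |s₁ + s₂ - d / p| + 2 * |s₂|) else 0) +
      (if |j - k| ≤ 2 ∧ l ≤ k then (2:ℝ≥0∞) ^ (2 * |s₁ + s₂ - d / p| + 2 * |s₂|) *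
        (2:ℝ≥0∞) ^ (((l - k : ℤ):ℝ) * (d / p - s₂)) else 0) +
      (if |l - k| ≤ 2 ∧ j - k ≤ 4 then (2:ℝ≥0∞) ^ (2 * |s₁ + s₂ - d / p| + 2 * |s₂|) *
        (2:ℝ≥0∞) ^ (((j - k : ℤ):ℝ) * (s₁ + s₂ - remainderLoss d p)) else 0) := by
  have hmul : ∀ (n : ℤ) (t : ℝ), |n| ≤ 2 → (n:ℝ) * t ≤ 2 * |t| := fun n t hn => by
    refine (le_abs_self _).trans ?_
    rw [abs_mul]
    gcongr
    exact_mod_cast hn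
  have hσ := abs_nonneg (s₁ + s₂ - d / p)
  have hs := abs_nonneg s₂
  rw [besovWeight, interactionWeight]
  simp only [← ENNReal.rpow_add _ _ (two_ne_zero) (ENNReal.ofNat_ne_top), mul_ite, mul_zero]
  by_cases h1 : k ≤ l - 3
  · rw [if_pos h1]
    by_cases h2 : |j - l| ≤ 2
    swap
    · rw [if_neg h2]
      exact zero_le
    rw [if_pos h2, if_pos h2, add_assoc]
    refine le_add_right (ENNReal.rpow_le_rpow_of_exponent_le (by norm_num) ?_)
    have := hmul _ (s₁ + s₂ - d / p) h2
    have h4 : (k:ℝ) - l ≤ 0 := by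
      have : (k:ℝ) ≤ l := by exact_mod_cast (by lia : k ≤ l)
      linarith
    push_cast at this
    nlinarith
  rw [if_neg h1]
  by_cases h2 : l ≤ k - 3
  · rw [if_pos h2]
    by_cases h3 : |j - k| ≤ 2
    swap
    · rw [if_neg h3]
      exact zero_le
    rw [if_pos h3, if_pos (⟨h3, by lia⟩ : |j - k| ≤ 2 ∧ l ≤ k)]
    refine le_add_right (le_add_left (ENNReal.rpow_le_rpow_of_exponent_le (by norm_num) ?_))
    have := hmul _ (s₁ + s₂ - d / p) h3
    push_cast at this ⊢
    nlinarith
  rw [if_neg h2]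
  by_cases h3 : j ≤ k + 4
  swap
  · rw [if_neg h3]
    exact zero_le
  have h4 : |l - k| ≤ 2 := abs_le.2 ⟨by lia, by lia⟩
  rw [if_pos h3, if_pos (⟨h4, by lia⟩ : |l - k| ≤ 2 ∧ j - k ≤ 4)]
  refine le_add_left (ENNReal.rpow_le_rpow_of_exponent_le (by norm_num) ?_)
  have := hmul (k - l) s₂ (by rwa [abs_sub_comm])
  push_cast at this ⊢
  nlinarith

theorem tsum_int_sub_left (f : ℤ → ℝ≥0∞) (k : ℤ) : ∑' l, f (k - l) = ∑' n, f n :=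
  (Equiv.subLeft k).tsum_eq f

theorem tsum_int_sub_right (f : ℤ → ℝ≥0∞) (k : ℤ) : ∑' j, f (j - k) = ∑' n, f n :=
  (Equiv.subRight k).tsum_eq f

theorem exists_tsum_besovWeight_output_le {d : ℕ} {p s₁ s₂ : ℝ} (hs₁ : s₁ ≤ d / p)
    (hs₂ : s₂ ≤ d / p) (hs : remainderLoss d p < s₁ + s₂) :
    ∃ K : ℝ≥0, ∀ k l, ∑' j, besovWeight d p s₁ s₂ j k l ≤ K := by
  set c := (2:ℝ≥0∞) ^ (2 * |s₁ + s₂ - d / p| + 2 * |s₂|)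
  have hc : c ≠ ∞ := by finiteness
  have f1 := tsum_int_ite_abs_le_ne_top hc 2
  have f2 := tsum_int_rpow_ite_le_ne_top (sub_pos.2 hs) 4
  set S₁ := ∑' n : ℤ, (if |n| ≤ 2 then c else 0)
  set S₂ := ∑' n : ℤ, (if n ≤ 4 then (2:ℝ≥0∞) ^ ((n:ℝ) * (s₁ + s₂ - remainderLoss d p)) else 0)
   
  have hfin : S₁ + S₁ + c * S₂ ≠ ∞ := by finiteness
  refine ⟨(S₁ + S₁ + c * S₂).toNNReal, fun k l => ?_⟩
  rw [ENNReal.coe_toNNReal hfin]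
  have e : S₁ + S₁ + c * S₂ = ∑' j : ℤ, ((if |j - l| ≤ 2 then c else 0) +
      (if |j - k| ≤ 2 then c else 0) + c * (if j - k ≤ 4 then
        (2:ℝ≥0∞) ^ (((j - k : ℤ):ℝ) * (s₁ + s₂ - remainderLoss d p)) else 0)) := by
    rw [ENNReal.tsum_add, ENNReal.tsum_add, ENNReal.tsum_mul_left,
      tsum_int_sub_right (fun n => if |n| ≤ 2 then c else 0) l,
      tsum_int_sub_right (fun n => if |n| ≤ 2 then c else 0) k,
      tsum_int_sub_right (fun n : ℤ => if n ≤ 4 then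
        (2:ℝ≥0∞) ^ ((n:ℝ) * (s₁ + s₂ - remainderLoss d p)) else 0) k]
  rw [e]
  refine ENNReal.tsum_le_tsum fun j => (besovWeight_le hs₁ j k l).trans ?_
  refine add_le_add (add_le_add le_rfl ?_) ?_
  · split_ifs with h1 h2
    · refine mul_le_of_le_one_right' ?_
      rw [← ENNReal.rpow_zero (x := 2)]
      refine ENNReal.rpow_le_rpow_of_exponent_le (by norm_num) ?_
      exact mul_nonpos_of_nonpos_of_nonneg (by exact_mod_cast (by lia : l - k ≤ 0)) (by linarith)
    · exact absurd h1.1 h2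
    all_goals exact zero_le
  · rw [mul_ite, mul_zero]
    split_ifs with h1 h2
    · exact le_rfl
    · exact absurd h1.2 h2
    all_goals exact zero_le

theorem exists_tsum_besovWeight_input_le {d : ℕ} {p s₁ s₂ : ℝ} (hs₁ : s₁ ≤ d / p)
    (hs₂ : s₂ < d / p) (hs : remainderLoss d p ≤ s₁ + s₂) :
    ∃ K : ℝ≥0, ∀ j k, ∑' l, besovWeight d p s₁ s₂ j k l ≤ K := by
  set c := (2:ℝ≥0∞) ^ (2 * |s₁ + s₂ - d / p| + 2 * |s₂|)
  have hc : c ≠ ∞ := by finiteness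
  set c' := c * (2:ℝ≥0∞) ^ (4 * (s₁ + s₂ - remainderLoss d p))
  have hc' : c' ≠ ∞ := by finiteness
  have f1 := tsum_int_ite_abs_le_ne_top hc 2
  have f2 := tsum_int_rpow_ite_le_ne_top (sub_pos.2 hs₂) 0
  have f3 := tsum_int_ite_abs_le_ne_top hc' 2
  set S₁ := ∑' n : ℤ, (if |n| ≤ 2 then c else 0)
  set S₂ := ∑' n : ℤ, (if n ≤ 0 then (2:ℝ≥0∞) ^ ((n:ℝ) * (d / p - s₂)) else 0)
  set S₃ := ∑' n : ℤ, (if |n| ≤ 2 then c' else 0)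
  have hfin : S₁ + c * S₂ + S₃ ≠ ∞ := by finiteness
  refine ⟨(S₁ + c * S₂ + S₃).toNNReal, fun j k => ?_⟩
  rw [ENNReal.coe_toNNReal hfin]
  have e : S₁ + c * S₂ + S₃ = ∑' l : ℤ, ((if |j - l| ≤ 2 then c else 0) +
      c * (if l - k ≤ 0 then (2:ℝ≥0∞) ^ (((l - k : ℤ):ℝ) * (d / p - s₂)) else 0) +
      (if |l - k| ≤ 2 then c' else 0)) := by
    rw [ENNReal.tsum_add, ENNReal.tsum_add, ENNReal.tsum_mul_left,
      tsum_int_sub_left (fun n => if |n| ≤ 2 then c else 0) j,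
      tsum_int_sub_right (fun n => if |n| ≤ 2 then c' else 0) k,
      tsum_int_sub_right (fun n : ℤ => if n ≤ 0 then
        (2:ℝ≥0∞) ^ ((n:ℝ) * (d / p - s₂)) else 0) k]
  rw [e]
  refine ENNReal.tsum_le_tsum fun l => (besovWeight_le hs₁ j k l).trans ?_
  refine add_le_add (add_le_add le_rfl ?_) ?_
  · rw [mul_ite, mul_zero]
    split_ifs with h1 h2
    · exact le_rfl
    · exact absurd (by lia) h2
    all_goals exact zero_le
  · split_ifs with h1 h2
    · refine mul_le_mul_right (ENNReal.rpow_le_rpow_of_exponent_le (by norm_num) ?_) _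
      exact mul_le_mul_of_nonneg_right (by exact_mod_cast h1.2) (by linarith)
    · exact absurd h1.1 h2
    all_goals exact zero_le

theorem seqNorm_one (u : ℤ → ℝ≥0∞) : seqNorm 1 u = ∑' j, u j := by
  simp [seqNorm]

theorem seqNorm_top (u : ℤ → ℝ≥0∞) : seqNorm ∞ u = ⨆ j, u j := by
  simp [seqNorm]

theorem rpow_mul_interactionWeight_eq {d : ℕ} {p s₁ s₂ : ℝ} (j k l : ℤ) (K x y : ℝ≥0∞) :
    ENNReal.ofReal ((2:ℝ) ^ ((j:ℝ) * (s₁ + s₂ - d / p))) * (K * interactionWeight d p j k l * x * y) =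
      K * besovWeight d p s₁ s₂ j k l * (ENNReal.ofReal ((2:ℝ) ^ ((k:ℝ) * s₁)) * x) *
        (ENNReal.ofReal ((2:ℝ) ^ ((l:ℝ) * s₂)) * y) := by
  have e : ∀ t : ℝ, ENNReal.ofReal ((2:ℝ) ^ t) = (2:ℝ≥0∞) ^ t := fun t => by
    rw [← ENNReal.ofReal_rpow_of_pos (by norm_num)]
    simp
  have e2 : (2:ℝ≥0∞) ^ ((j:ℝ) * (s₁ + s₂ - d / p)) =
      (2:ℝ≥0∞) ^ ((j:ℝ) * (s₁ + s₂ - d / p) - k * s₁ - l * s₂) * (2:ℝ≥0∞) ^ ((k:ℝ) * s₁) *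
        (2:ℝ≥0∞) ^ ((l:ℝ) * s₂) := by
    rw [← ENNReal.rpow_add _ _ (by norm_num) (by norm_num),
      ← ENNReal.rpow_add _ _ (by norm_num) (by norm_num)]
    congr 1
    ring
  rw [e, e, e, e2, besovWeight]
  ring

/-- Gevrey product estimates in Besov spaces (1 < p < ∞), uniform in τ ≥ 0, with
f = e^{−τΛ₁}A and g = e^{−τΛ₁}B:
(1) if s₁, s₂ ≤ d/p and s₁ + s₂ > d·max(0, 2/p − 1), then
‖e^{τΛ₁}(fg)‖_{Ḃ^{s₁+s₂−d/p}_{p,1}} ≲ ‖A‖_{Ḃ^{s₁}_{p,1}}·‖B‖_{Ḃ^{s₂}_{p,1}};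
(2) if s₁ ≤ d/p, s₂ < d/p and s₁ + s₂ ≥ d·max(0, 2/p − 1), then
‖e^{τΛ₁}(fg)‖_{Ḃ^{s₁+s₂−d/p}_{p,∞}} ≲ ‖A‖_{Ḃ^{s₁}_{p,1}}·‖B‖_{Ḃ^{s₂}_{p,∞}}. -/
theorem gevrey_besov_product_estimates
    (d : ℕ) (hd : 1 ≤ d) (φ : Rd d → ℝ)
    (hφ1 : ContDiff ℝ (⊤ : ℕ∞) φ)
    (hφ2 : ∀ x y : Rd d, ‖x‖ = ‖y‖ → φ x = φ y)
    (hφ3 : ∀ x : Rd d, φ x ≠ 0 → 3/4 ≤ ‖x‖ ∧ ‖x‖ ≤ 8/3)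
    (hφ4 : ∀ ξ : Rd d, ξ ≠ 0 → ∑' j : ℤ, φ (((2:ℝ) ^ (-j)) • ξ) = 1)
    (p : ℝ) (hp : 1 < p) :
    (∀ s₁ s₂ : ℝ, s₁ ≤ (d : ℝ)/p → s₂ ≤ (d : ℝ)/p →
      (d : ℝ) * max 0 (2/p - 1) < s₁ + s₂ →
      ∃ C : ℝ, 0 < C ∧ ∀ τ : ℝ, 0 ≤ τ → ∀ A B : 𝓢(Rd d, ℂ),
        besovNorm d φ (s₁ + s₂ - (d : ℝ)/p) (ENNReal.ofReal p) 1
            (expL1 d τ (fun x => expL1 d (-τ) (⇑A) x * expL1 d (-τ) (⇑B) x))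
          ≤ ENNReal.ofReal C * besovNorm d φ s₁ (ENNReal.ofReal p) 1 A
              * besovNorm d φ s₂ (ENNReal.ofReal p) 1 B) ∧
    (∀ s₁ s₂ : ℝ, s₁ ≤ (d : ℝ)/p → s₂ < (d : ℝ)/p →
      (d : ℝ) * max 0 (2/p - 1) ≤ s₁ + s₂ →
      ∃ C : ℝ, 0 < C ∧ ∀ τ : ℝ, 0 ≤ τ → ∀ A B : 𝓢(Rd d, ℂ),
        besovNorm d φ (s₁ + s₂ - (d : ℝ)/p) (ENNReal.ofReal p) ∞
            (expL1 d τ (fun x => expL1 d (-τ) (⇑A) x * expL1 d (-τ) (⇑B) x))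
          ≤ ENNReal.ofReal C * besovNorm d φ s₁ (ENNReal.ofReal p) 1 A
              * besovNorm d φ s₂ (ENNReal.ofReal p) ∞ B) := by
  have : NeZero d := ⟨by lia⟩
  have h : IsDyadicProfile φ := ⟨hφ1, hφ3, hφ4⟩
  obtain ⟨K, hK⟩ := h.exists_eLpNorm_LPblock_expL1_le hp
  have hKL : ∀ L : ℝ≥0, (K * L : ℝ≥0∞) ≤ ENNReal.ofReal (K * L + 1 : ℝ) := fun L => by
    rw [← ENNReal.coe_mul, ← ENNReal.ofReal_coe_nnreal]
    exact ENNReal.ofReal_le_ofReal (by push_cast; linarith)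
  refine ⟨fun s₁ s₂ hs₁ hs₂ hs => ?_, fun s₁ s₂ hs₁ hs₂ hs => ?_⟩
  · obtain ⟨L, hL⟩ := exists_tsum_besovWeight_output_le hs₁ hs₂ hs
    refine ⟨K * L + 1, by positivity, fun τ hτ A B => ?_⟩
    simp only [besovNorm, seqNorm_one]
    set a : ℤ → ℝ≥0∞ := fun k => ENNReal.ofReal ((2:ℝ) ^ ((k:ℝ) * s₁)) *
      eLpNorm (LPblock d φ k A) (ENNReal.ofReal p) volume
    set b : ℤ → ℝ≥0∞ := fun l => ENNReal.ofReal ((2:ℝ) ^ ((l:ℝ) * s₂)) *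
      eLpNorm (LPblock d φ l B) (ENNReal.ofReal p) volume
    calc _ ≤ ∑' j, ∑' k, ∑' l, K * besovWeight d p s₁ s₂ j k l * a k * b l := by
          refine ENNReal.tsum_le_tsum fun j => (mul_le_mul_right (hK τ hτ A B j) _).trans_eq ?_
          simp_rw [← ENNReal.tsum_mul_left, rpow_mul_interactionWeight_eq]
          rfl
      _ = ∑' k, ∑' l, K * (∑' j, besovWeight d p s₁ s₂ j k l) * a k * b l := by
          rw [ENNReal.tsum_comm]
          refine tsum_congr fun k => ?_
          rw [ENNReal.tsum_comm]
          simp_rw [ENNReal.tsum_mul_right, ENNReal.tsum_mul_left]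
      _ ≤ ∑' k, ∑' l, ENNReal.ofReal (K * L + 1 : ℝ) * a k * b l := by
          gcongr with k l
          exact (mul_le_mul_right (hL k l) _).trans (hKL L)
      _ = _ := by
          simp_rw [ENNReal.tsum_mul_left, ENNReal.tsum_mul_right, ENNReal.tsum_mul_left]
  · obtain ⟨L, hL⟩ := exists_tsum_besovWeight_input_le hs₁ hs₂ hs
    refine ⟨K * L + 1, by positivity, fun τ hτ A B => ?_⟩
    simp only [besovNorm, seqNorm_one, seqNorm_top]
    set a : ℤ → ℝ≥0∞ := fun k => ENNReal.ofReal ((2:ℝ) ^ ((k:ℝ) * s₁)) *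
      eLpNorm (LPblock d φ k A) (ENNReal.ofReal p) volume
    set b : ℤ → ℝ≥0∞ := fun l => ENNReal.ofReal ((2:ℝ) ^ ((l:ℝ) * s₂)) *
      eLpNorm (LPblock d φ l B) (ENNReal.ofReal p) volume
    refine iSup_le fun j => ?_
    calc _ ≤ ∑' k, ∑' l, K * besovWeight d p s₁ s₂ j k l * a k * b l := by
          refine (mul_le_mul_right (hK τ hτ A B j) _).trans_eq ?_
          simp_rw [← ENNReal.tsum_mul_left, rpow_mul_interactionWeight_eq]
          rfl
      _ ≤ ∑' k, ∑' l, K * besovWeight d p s₁ s₂ j k l * a k * ⨆ l, b l := by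
          gcongr with k l
          exact le_iSup b l
      _ = ∑' k, K * (∑' l, besovWeight d p s₁ s₂ j k l) * a k * ⨆ l, b l := by
          simp_rw [ENNReal.tsum_mul_right, ENNReal.tsum_mul_left]
      _ ≤ ∑' k, ENNReal.ofReal (K * L + 1 : ℝ) * a k * ⨆ l, b l := by
          gcongr with k
          exact (mul_le_mul_right (hL j k) _).trans (hKL L)
      _ = _ := by
          rw [ENNReal.tsum_mul_right, ENNReal.tsum_mul_left]
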